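/- arXiv:1801.05320 — 2 statements merged into one kernel-verified Lean document; each statement's English description precedes it below -/
import Mathlib

section
/- Suppose that for every subset J ⊆ {1,…,n−1} the standard parabolic subgroup P_J(R) ≤ SL_n(R) is finitely generated. Then for every nonempty subset I ⊆ {1,…,n−1}, the parabolic subgroup P_I(R) is finitely presented if and only if its extended Levi factor LE_I(R) is finitely presented. (This is the main theorem of the paper in the simply-laced type A_{n−1}, where every commutative ring satisfies the QG condition and no G_2 exception arises.) -/
/-- A group is finitely presented if it is isomorphic to the quotient of a
finitely generated free group by the normal closure of a finite set. -/
def IsFinitelyPresented (G : Type*) [Group G] : Prop :=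
  ∃ (m : ℕ) (S : Finset (FreeGroup (Fin m))),
    Nonempty ((FreeGroup (Fin m) ⧸ Subgroup.normalClosure (S : Set (FreeGroup (Fin m)))) ≃* G)

/-- The elementary matrix `1 + r·E i j` as an element of `SL_n(R)`. -/
def elemMat {n : ℕ} {R : Type*} [CommRing R] (i j : Fin n) (hij : i ≠ j) (r : R) :
    Matrix.SpecialLinearGroup (Fin n) R :=
  ⟨Matrix.transvection i j r, Matrix.det_transvection_of_ne i j hij r⟩

/-- The set of diagonal matrices in `SL_n(R)`. -/
def diagMats (n : ℕ) (R : Type*) [CommRing R] :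
    Set (Matrix.SpecialLinearGroup (Fin n) R) :=
  {g | (g : Matrix (Fin n) (Fin n) R).IsDiag}

/-- For (0-based) indices `i < j` in `Fin n`, the (1-based) pair `(i+1, j+1)` is
`I`-connected if every simple-root index `k` with `i+1 ≤ k ≤ j` lies in `I`. -/
def IConn {n : ℕ} (I : Set ℕ) (i j : Fin n) : Prop :=
  ∀ k : ℕ, i.val + 1 ≤ k → k ≤ j.val → k ∈ I

/-- Upper elementary matrices `e_{ij}(r)` with `i < j` a `J`-connected pair. -/
def upperElems (n : ℕ) (R : Type*) [CommRing R] (J : Set ℕ) :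
    Set (Matrix.SpecialLinearGroup (Fin n) R) :=
  {g | ∃ (i j : Fin n) (h : i < j) (r : R), IConn J i j ∧ g = elemMat i j (ne_of_lt h) r}

/-- All upper elementary matrices `e_{ij}(r)`, `i < j`. -/
def allUpperElems (n : ℕ) (R : Type*) [CommRing R] :
    Set (Matrix.SpecialLinearGroup (Fin n) R) :=
  {g | ∃ (i j : Fin n) (h : i < j) (r : R), g = elemMat i j (ne_of_lt h) r}

/-- Lower elementary matrices `e_{ji}(r)` with `i < j` an `I`-connected pair. -/
def lowerElems (n : ℕ) (R : Type*) [CommRing R] (I : Set ℕ) :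
    Set (Matrix.SpecialLinearGroup (Fin n) R) :=
  {g | ∃ (i j : Fin n) (h : i < j) (r : R), IConn I i j ∧ g = elemMat j i (ne_of_gt h) r}

/-- The standard parabolic subgroup `P_I(R) ≤ SL_n(R)`. -/
def parabolic (n : ℕ) (R : Type*) [CommRing R] (I : Set ℕ) :
    Subgroup (Matrix.SpecialLinearGroup (Fin n) R) :=
  Subgroup.closure (diagMats n R ∪ allUpperElems n R ∪ lowerElems n R I)

/-- The Levi factor `L_I(R) ≤ SL_n(R)`. -/
def levi (n : ℕ) (R : Type*) [CommRing R] (I : Set ℕ) :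
    Subgroup (Matrix.SpecialLinearGroup (Fin n) R) :=
  Subgroup.closure (diagMats n R ∪ upperElems n R I ∪ lowerElems n R I)

/-- `Adj(I)`: simple-root indices not in `I` adjacent to an element of `I`. -/
def adjSet (n : ℕ) (I : Set ℕ) : Set ℕ :=
  {k | k ∈ Set.Icc 1 (n - 1) ∧ k ∉ I ∧ (k - 1 ∈ I ∨ k + 1 ∈ I)}

/-- `nonAdj(I)`: simple-root indices neither in `I` nor adjacent to `I`. -/
def nonAdjSet (n : ℕ) (I : Set ℕ) : Set ℕ :=
  Set.Icc 1 (n - 1) \ (I ∪ adjSet n I)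

/-- The extended Levi factor `LE_I(R)` (for `I ≠ ∅`): generated by the Levi factor
together with all `e_{ij}(r)`, `i < j` a `nonAdj(I)`-connected pair. -/
def extLevi (n : ℕ) (R : Type*) [CommRing R] (I : Set ℕ) :
    Subgroup (Matrix.SpecialLinearGroup (Fin n) R) :=
  Subgroup.closure (diagMats n R ∪ upperElems n R I ∪ lowerElems n R I ∪
    upperElems n R (nonAdjSet n I))

theorem isFinitelyPresented_iff_group (G : Type*) [Group G] :
    IsFinitelyPresented G ↔ Group.IsFinitelyPresented G := by
  constructor
  · rintro ⟨m, S, ⟨e⟩⟩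
    have : Group.IsFinitelyPresented
        (FreeGroup (Fin m) ⧸ Subgroup.normalClosure (S : Set (FreeGroup (Fin m)))) :=
      Group.IsFinitelyPresented.quotient _ ⟨S, S.finite_toSet, rfl⟩
    exact Group.IsFinitelyPresented.equiv e
  · rintro ⟨m, φ, hφ, S, hS, hker⟩
    refine ⟨m, hS.toFinset, ⟨(QuotientGroup.quotientMulEquivOfEq ?_).trans
      (QuotientGroup.quotientKerEquivOfSurjective φ hφ)⟩⟩
    rw [hS.coe_toFinset, hker]

theorem Group.IsFinitelyPresented.of_retract {G H : Type*} [Group G] [Group H]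
    [Group.IsFinitelyPresented G] (r : G →* H) (s : H →* G) (hrs : ∀ h, r (s h) = h) :
    Group.IsFinitelyPresented H := by
  obtain ⟨m, φ, hφ, -⟩ := Group.IsFinitelyPresented.out (G := G)
  obtain ⟨X, hX, hXfin⟩ := Group.fg_iff.mp (Group.fg_of_surjective hφ)
  refine Group.IsFinitelyPresented.of_surjective r (fun h => ⟨s h, hrs h⟩)
    ⟨(fun x => x⁻¹ * s (r x)) '' X, hXfin.image _, le_antisymm ?_ ?_⟩
  · refine Subgroup.normalClosure_le_normal ?_
    rintro _ ⟨x, -, rfl⟩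
    simp [MonoidHom.mem_ker, hrs]
  · set N := Subgroup.normalClosure ((fun x => x⁻¹ * s (r x)) '' X)
    have key : (QuotientGroup.mk' N) = ((QuotientGroup.mk' N).comp s).comp r := by
      refine MonoidHom.eq_of_eqOn_dense hX fun x hx => ?_
      exact QuotientGroup.eq.mpr (Subgroup.subset_normalClosure ⟨x, hx, rfl⟩)
    intro x hx
    rw [← QuotientGroup.eq_one_iff]
    have := DFunLike.congr_fun key x
    simpa [MonoidHom.mem_ker.mp hx] using this

theorem Group.FG.of_injective {A B : Type*} [CommGroup A] [Group B] [Group.FG A] (f : B →* A)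
    (hf : Function.Injective f) : Group.FG B := by
  let : CommGroup B := { (inferInstance : Group B) with
    mul_comm := fun a b => hf (by simp [mul_comm]) }
  have : Module.Finite ℤ (Additive A) := Module.Finite.iff_addGroup_fg.mpr inferInstance
  have : Module.Finite ℤ (Additive B) :=
    Module.Finite.of_injective (MonoidHom.toAdditive f).toIntLinearMap hf
  exact GroupFG.iff_add_fg.mpr (Module.Finite.iff_addGroup_fg.mp this)

/-- The subgroup generated by the conjugates of `y g`, `g : Γ`, by the image of `s`. -/
def conjSpan {T G Γ : Type*} [Group T] [Group G] (s : T →* G) (y : Γ → G) : Subgroup G :=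
  Subgroup.closure {x | ∃ t g, x = s t * y g * (s t)⁻¹}

section conjSpan

variable {T G H Γ : Type*} [Group T] [Group G] [Group H] (s : T →* G) (y : Γ → G)

theorem conj_mem_conjSpan (t : T) (g : Γ) : s t * y g * (s t)⁻¹ ∈ conjSpan s y :=
  Subgroup.subset_closure ⟨t, g, rfl⟩

theorem mem_conjSpan (g : Γ) : y g ∈ conjSpan s y := by
  simpa using conj_mem_conjSpan s y 1 g

theorem conjSpan_le {s : T →* G} {y : Γ → G} {K : Subgroup G}
    (h : ∀ t g, s t * y g * (s t)⁻¹ ∈ K) : conjSpan s y ≤ K := by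
  rw [conjSpan, Subgroup.closure_le]
  rintro _ ⟨t, g, rfl⟩
  exact h t g

theorem conjSpan_conj (t : T) {v : G} (hv : v ∈ conjSpan s y) :
    s t * v * (s t)⁻¹ ∈ conjSpan s y := by
  have : conjSpan s y ≤ (conjSpan s y).comap (MulAut.conj (s t)).toMonoidHom := by
    refine conjSpan_le fun u g => ?_
    have := conj_mem_conjSpan s y (t * u) g
    simpa [mul_assoc] using this
  simpa using this hv

theorem conjSpan_map (φ : G →* H) :
    (conjSpan s y).map φ = conjSpan (φ.comp s) (φ ∘ y) := by
  rw [conjSpan, conjSpan, MonoidHom.map_closure]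
  congr 1
  ext x
  constructor
  · rintro ⟨_, ⟨t, g, rfl⟩, rfl⟩
    exact ⟨t, g, by simp⟩
  · rintro ⟨t, g, rfl⟩
    exact ⟨_, ⟨t, g, rfl⟩, by simp⟩

end conjSpan

theorem exists_finite_le_normalClosure {T G Γ : Type*} [CommGroup T] [Group.FG T] [Group G]
    [Finite Γ] (s : T →* G) (y : Γ → G)
    (hcomm : ∀ a ∈ conjSpan s y, ∀ b ∈ conjSpan s y, a * b = b * a)
    (A : Subgroup G) (hA : A ≤ conjSpan s y) (hconj : ∀ t, ∀ a ∈ A, s t * a * (s t)⁻¹ ∈ A) :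
    ∃ F : Set G, F.Finite ∧ F ⊆ A ∧ A ≤ Subgroup.normalClosure F := by
  set V := conjSpan s y with hV
  let : CommGroup V := { (inferInstance : Group V) with
    mul_comm := fun a b => Subtype.ext (hcomm a a.2 b b.2) }
  let c (t : T) : V →* V :=
    { toFun := fun v => ⟨s t * v * (s t)⁻¹, conjSpan_conj s y t v.2⟩
      map_one' := by ext; simp
      map_mul' := fun a b => by ext; simp }
  let ρ : Representation ℤ T (Additive V) :=
    { toFun := fun t => (MonoidHom.toAdditive (c t)).toIntLinearMap
      map_one' := by
        ext v
        simp [c]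
      map_mul' := fun a b => by
        ext v
        simp [c, mul_assoc] }
  let em (v : V) : ρ.asModule := ρ.asModuleEquiv.symm (Additive.ofMul v)
  have hsmul (t : T) (v : V) : MonoidAlgebra.of ℤ T t • em v = em (c t v) := by
    rw [← Representation.asModuleEquiv_symm_map_rho]
    rfl
  have hem_mul (v w : V) : em (v * w) = em v + em w := rfl
  have hem_inv (v : V) : em v⁻¹ = - em v := rfl
  have hem_surj (m : ρ.asModule) : ∃ v, em v = m := ⟨Additive.toMul (ρ.asModuleEquiv m), rfl⟩
  have hfin : Module.Finite (MonoidAlgebra ℤ T) ρ.asModule := by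
    refine ⟨⟨(Set.finite_range fun g : Γ => em ⟨y g, mem_conjSpan s y g⟩).toFinset, ?_⟩⟩
    rw [Set.Finite.coe_toFinset, eq_top_iff]
    rintro m -
    obtain ⟨⟨v, hv⟩, rfl⟩ := hem_surj m
    induction hv using Subgroup.closure_induction with
    | mem x hx =>
      obtain ⟨t, g, rfl⟩ := hx
      have := Submodule.smul_mem _ (MonoidAlgebra.of ℤ T t) (Submodule.subset_span
        (R := MonoidAlgebra ℤ T) (Set.mem_range_self (f := fun g : Γ => em ⟨y g, mem_conjSpan s y g⟩) g))
      rwa [hsmul] at this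
    | one => exact Submodule.zero_mem _
    | mul a b ha hb iha ihb => exact Submodule.add_mem _ iha ihb
    | inv a ha iha => exact Submodule.neg_mem _ iha
  have : IsNoetherianRing (MonoidAlgebra ℤ T) := Algebra.FiniteType.isNoetherianRing ℤ _
  have hcA (r : MonoidAlgebra ℤ T) (v : V) (hv : (v : G) ∈ A) :
      ∃ w : V, (w : G) ∈ A ∧ r • em v = em w := by
    induction r using MonoidAlgebra.induction_on with
    | of t => exact ⟨c t v, hconj t _ hv, hsmul t v⟩
    | add a b ha hb =>
      obtain ⟨w, hw, h⟩ := ha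
      obtain ⟨w', hw', h'⟩ := hb
      exact ⟨w * w', A.mul_mem hw hw', by rw [add_smul, h, h', hem_mul]⟩
    | smul k a ha =>
      obtain ⟨w, hw, h⟩ := ha
      exact ⟨w ^ k, by simpa using A.zpow_mem hw k, by rw [smul_assoc, h]; rfl⟩
  let A' : Submodule (MonoidAlgebra ℤ T) ρ.asModule :=
    { carrier := {m | ∃ v : V, (v : G) ∈ A ∧ em v = m}
      add_mem' := by
        rintro _ _ ⟨v, hv, rfl⟩ ⟨w, hw, rfl⟩
        exact ⟨v * w, A.mul_mem hv hw, rfl⟩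
      zero_mem' := ⟨1, A.one_mem, rfl⟩
      smul_mem' := by
        rintro r _ ⟨v, hv, rfl⟩
        obtain ⟨w, hw, h⟩ := hcA r v hv
        exact ⟨w, hw, h.symm⟩ }
  obtain ⟨S, hS⟩ := (isNoetherian_def.mp inferInstance A' : A'.FG)
  have hinj : Function.Injective em := fun _ _ h => h
  refine ⟨(fun v : V => (v : G)) '' (em ⁻¹' S),
    (S.finite_toSet.preimage hinj.injOn).image _, ?_, ?_⟩
  · rintro _ ⟨v, hv, rfl⟩
    have : em v ∈ A' := hS ▸ Submodule.subset_span hv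
    obtain ⟨w, hw, h⟩ := this
    exact hinj h ▸ hw
  · set N := Subgroup.normalClosure ((fun v : V => (v : G)) '' (em ⁻¹' S))
    have hN (m : ρ.asModule) (hm : m ∈ Submodule.span (MonoidAlgebra ℤ T) (S : Set ρ.asModule)) :
        ∀ v : V, em v = m → (v : G) ∈ N := by
      induction hm using Submodule.span_induction with
      | mem x hx =>
        rintro v rfl
        exact Subgroup.subset_normalClosure ⟨v, hx, rfl⟩
      | zero => 
        intro v hv
        have : v = 1 := hinj hv
        simp [this]
      | add a b _ _ iha ihb =>
        intro v hv
        obtain ⟨a, rfl⟩ := hem_surj a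
        obtain ⟨b, rfl⟩ := hem_surj b
        have : v = a * b := hinj hv
        rw [this]
        exact N.mul_mem (iha a rfl) (ihb b rfl)
      | smul r a _ iha =>
        obtain ⟨a, rfl⟩ := hem_surj a
        have ha := iha a rfl
        induction r using MonoidAlgebra.induction_on with
        | of t =>
          intro v hv
          rw [hsmul] at hv
          rw [hinj hv]
          exact Subgroup.Normal.conj_mem inferInstance _ ha _
        | add p q hp hq =>
          intro v hv
          obtain ⟨w, hw⟩ := hem_surj (p • em a)
          obtain ⟨w', hw'⟩ := hem_surj (q • em a)
          rw [add_smul, ← hw, ← hw', ← hem_mul] at hv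
          rw [hinj hv]
          exact N.mul_mem (hp w hw) (hq w' hw')
        | smul k p hp =>
          intro v hv
          obtain ⟨w, hw⟩ := hem_surj (p • em a)
          rw [smul_assoc, ← hw] at hv
          have : v = w ^ k := hinj hv
          rw [this]
          simpa using N.zpow_mem (hp w hw) k
    intro a ha
    refine hN (em ⟨a, hA ha⟩) ?_ ⟨a, hA ha⟩ rfl
    rw [hS]
    exact ⟨_, ha, rfl⟩

section ElementaryMatrices

open Matrix
open scoped commutatorElement

variable {n : ℕ} {R : Type*} [CommRing R]

/-- The elementary matrix `1 + r·E i j`, with junk value `1` for `i = j`. -/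
def elem (i j : Fin n) (r : R) : Matrix.SpecialLinearGroup (Fin n) R :=
  if h : i ≠ j then elemMat i j h r else 1

theorem elem_of_ne {i j : Fin n} (h : i ≠ j) (r : R) : elem i j r = elemMat i j h r := dif_pos h

theorem coe_elem {i j : Fin n} (h : i ≠ j) (r : R) :
    (elem i j r : Matrix (Fin n) (Fin n) R) = 1 + single i j r := by
  rw [elem_of_ne h]
  rfl

theorem elem_add (i j : Fin n) (r s : R) : elem i j (r + s) = elem i j r * elem i j s := by
  by_cases h : i = j
  · simp [elem, h]
  · apply Subtype.ext
    rw [Matrix.SpecialLinearGroup.coe_mul, coe_elem h, coe_elem h, coe_elem h]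
    simp [mul_add, add_mul, single_add, Ne.symm h, add_assoc]

theorem elem_zero (i j : Fin n) : elem i j (0 : R) = 1 := by
  have := elem_add i j (0 : R) 0
  simpa using this

theorem elem_neg (i j : Fin n) (r : R) : elem i j (-r) = (elem i j r)⁻¹ := by
  rw [eq_inv_iff_mul_eq_one, ← elem_add, neg_add_cancel, elem_zero]

theorem commutator_elem {i j k l : Fin n} (hij : i ≠ j) (hkl : k ≠ l) (hil : i ≠ l) (r s : R) :
    ⁅elem i j r, elem k l s⁆ = if j = k then elem i l (r * s) else 1 := by
  rw [commutatorElement_def, mul_inv_eq_iff_eq_mul, mul_inv_eq_iff_eq_mul]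
  apply Subtype.ext
  split_ifs with hjk
  · subst hjk
    simp only [Matrix.SpecialLinearGroup.coe_mul, coe_elem hij, coe_elem hkl, coe_elem hil]
    simp [mul_add, add_mul, hil.symm, hkl.symm]
    abel
  · simp only [Matrix.SpecialLinearGroup.coe_mul, coe_elem hij, coe_elem hkl, one_mul]
    simp [mul_add, add_mul, hil.symm, hjk]
    abel

theorem elem_mul_apply {i j : Fin n} (h : i ≠ j) (r : R) (A : Matrix.SpecialLinearGroup (Fin n) R)
    (a b : Fin n) : (elem i j r * A) a b = A a b + if a = i then r * A j b else 0 := by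
  rw [Matrix.SpecialLinearGroup.coe_mul, coe_elem h, add_mul, one_mul, Matrix.add_apply]
  split_ifs with hai
  · subst hai
    rw [single_mul_apply_same]
  · rw [single_mul_apply_of_ne _ _ _ _ _ hai]

theorem elem_apply_same {i j : Fin n} (h : i ≠ j) (r : R) : elem i j r i j = r := by
  rw [coe_elem h]
  simp [one_apply_ne h]

variable (n R) in
/-- Tuples of units with product one: the diagonal torus of `SL_n(R)`. -/
def unitTorus : Subgroup (Fin n → Rˣ) :=
  MonoidHom.ker { toFun := fun t => ∏ i, t i, map_one' := by simp,
                  map_mul' := fun a b => by simp [Finset.prod_mul_distrib] }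

theorem mem_unitTorus {t : Fin n → Rˣ} : t ∈ unitTorus n R ↔ ∏ i, t i = 1 := Iff.rfl

variable (n R) in
/-- The torus as a group of diagonal matrices. -/
def torusMat : unitTorus n R →* Matrix.SpecialLinearGroup (Fin n) R where
  toFun t := ⟨diagonal fun i => (t.1 i : R), by
    have h : ∏ i, t.1 i = 1 := t.2
    rw [det_diagonal, ← Units.coe_prod, h, Units.val_one]⟩
  map_one' := by
    apply Subtype.ext
    simp
  map_mul' a b := by
    apply Subtype.ext
    change diagonal _ = diagonal _ * diagonal _
    simp

theorem coe_torusMat (t : unitTorus n R) :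
    (torusMat n R t : Matrix (Fin n) (Fin n) R) = diagonal fun i => (t.1 i : R) := rfl

theorem torusMat_conj_elem (t : unitTorus n R) (i j : Fin n) (r : R) :
    torusMat n R t * elem i j r * (torusMat n R t)⁻¹ =
      elem i j (((t.1 i / t.1 j : Rˣ) : R) * r) := by
  by_cases h : i = j
  · simp [elem, h]
  · rw [mul_inv_eq_iff_eq_mul]
    apply Subtype.ext
    rw [Matrix.SpecialLinearGroup.coe_mul, Matrix.SpecialLinearGroup.coe_mul, coe_elem h, coe_elem h,
      coe_torusMat, mul_add, add_mul, mul_one, one_mul]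
    congr 1
    ext a b
    rw [diagonal_mul, mul_diagonal]
    by_cases hab : i = a ∧ j = b
    · obtain ⟨rfl, rfl⟩ := hab
      simp only [single_apply_same, div_eq_mul_inv, Units.val_mul]
      rw [mul_right_comm, mul_assoc _ _ (t.1 j : R), Units.inv_mul, mul_one]
    · rw [single_apply_of_ne _ _ _ _ _ hab, single_apply_of_ne _ _ _ _ _ hab, mul_zero, zero_mul]

theorem mem_diagMats_iff (g : Matrix.SpecialLinearGroup (Fin n) R) :
    g ∈ diagMats n R ↔ g ∈ Set.range (torusMat n R) := by
  constructor
  · intro hg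
    have hg' : diagonal (diag (g : Matrix (Fin n) (Fin n) R)) = g := IsDiag.diagonal_diag hg
    have hdet : ∏ i, g i i = 1 := by
      have := g.2
      rwa [← hg', det_diagonal] at this
    have hu (i) : IsUnit (g i i) :=
      isUnit_of_dvd_one
        (dvd_trans (Finset.dvd_prod_of_mem (fun i => g i i) (Finset.mem_univ i)) (dvd_of_eq hdet))
    refine ⟨⟨fun i => (hu i).unit, ?_⟩, ?_⟩
    · rw [mem_unitTorus]
      ext
      simpa [Units.coe_prod] using hdet
    · apply Subtype.ext
      exact hg'
  · rintro ⟨t, rfl⟩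
    exact isDiag_diagonal _

theorem exists_unitTorus_div_eq (hn : 3 ≤ n) {i j : Fin n} (hij : i ≠ j) (u : Rˣ) :
    ∃ t : unitTorus n R, t.1 i / t.1 j = u := by
  obtain ⟨k, hk⟩ : ∃ k : Fin n, k ∉ ({i, j} : Finset (Fin n)) := by
    by_contra! h
    have h1 := Finset.card_le_card (fun x _ => h x : (Finset.univ : Finset (Fin n)) ⊆ {i, j})
    have h2 := Finset.card_le_two (a := i) (b := j)
    rw [Finset.card_univ, Fintype.card_fin] at h1
    omega
  simp only [Finset.mem_insert, Finset.mem_singleton, not_or] at hk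
  refine ⟨⟨Pi.mulSingle i u * Pi.mulSingle k u⁻¹, ?_⟩, ?_⟩
  · rw [mem_unitTorus]
    simp [Finset.prod_mul_distrib]
  · simp [Ne.symm hk.1, Ne.symm hk.2, hij.symm]

theorem unitTorus_fg [Group.FG Rˣ] (H : Subgroup (unitTorus n R)) : Group.FG H :=
  Group.FG.of_injective ((unitTorus n R).subtype.comp H.subtype)
    (Subtype.val_injective.comp Subtype.val_injective)

/-- The kernel in the torus of the root `(i, j)`. -/
def rootKer (i j : Fin n) : Subgroup (unitTorus n R) where
  carrier := {t | t.1 i = t.1 j}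
  mul_mem' := by
    intro a b ha hb
    simp only [Set.mem_ofPred_eq] at *
    simp [ha, hb]
  one_mem' := rfl
  inv_mem' := by
    intro a ha
    simp only [Set.mem_ofPred_eq] at *
    simp [ha]

theorem mem_rootKer {i j : Fin n} {t : unitTorus n R} : t ∈ rootKer i j ↔ t.1 i = t.1 j := Iff.rfl

theorem pow_mem_rootKer_sup {i j k l : Fin n} (hij : i ≠ j) (hkl : (i, j) ≠ (k, l))
    (hlk : (i, j) ≠ (l, k)) (t : unitTorus n R) :
    t ^ n ∈ (rootKer i j ⊔ rootKer k l : Subgroup (unitTorus n R)) := by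
  have key (p : Fin n) (u : Rˣ) : (fun q => (Pi.mulSingle p u : Fin n → Rˣ) q ^ n * u⁻¹) ∈
      unitTorus n R := by
    rw [mem_unitTorus, Finset.prod_mul_distrib, Finset.prod_pow]
    simp
  obtain ⟨p, u, hp, hpij⟩ : ∃ (p : Fin n) (u : Rˣ), (p ≠ k ∧ p ≠ l) ∧
      (Pi.mulSingle p u : Fin n → Rˣ) i / (Pi.mulSingle p u : Fin n → Rˣ) j =
        t.1 i / t.1 j := by
    by_cases hi : i ≠ k ∧ i ≠ l
    · exact ⟨i, t.1 i / t.1 j, hi, by simp [hij.symm]⟩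
    · refine ⟨j, t.1 j / t.1 i, ?_, by simp [hij]⟩
      constructor
      · rintro rfl
        by_cases h : i = l
        · exact hlk (by rw [h])
        · exact hi ⟨hij, h⟩
      · rintro rfl
        by_cases h : i = k
        · exact hkl (by rw [h])
        · exact hi ⟨h, hij⟩
  set b : unitTorus n R := ⟨_, key p u⟩ with hb
  have hbkl : b ∈ (rootKer k l : Subgroup (unitTorus n R)) := by
    rw [mem_rootKer, hb]
    simp [hp.1.symm, hp.2.symm]
  have hbij : t ^ n * b⁻¹ ∈ (rootKer i j : Subgroup (unitTorus n R)) := by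
    rw [mem_rootKer, hb]
    have : (t.1 i / t.1 j) ^ n = _ := congrArg (· ^ n) hpij.symm
    simp only [div_pow] at this
    rw [div_eq_div_iff_mul_eq_mul] at this
    simp only [Subgroup.coe_mul, Subgroup.coe_pow, Subgroup.coe_inv, Pi.mul_apply, Pi.pow_apply,
      Pi.inv_apply, mul_inv, inv_inv, ← mul_assoc]
    congr 1
    rw [mul_inv_eq_iff_eq_mul, mul_right_comm, eq_mul_inv_iff_mul_eq, this, mul_comm]
  have := Subgroup.mul_mem_sup hbij hbkl
  rwa [inv_mul_cancel_right] at this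

theorem exists_finite_rootKer_cosets [Group.FG Rˣ] {i j k l : Fin n} (hij : i ≠ j)
    (hkl : (i, j) ≠ (k, l)) (hlk : (i, j) ≠ (l, k)) :
    ∃ C : Set (unitTorus n R), C.Finite ∧
      ∀ t, ∃ c ∈ C, ∃ a ∈ rootKer (R := R) i j, ∃ b ∈ rootKer (R := R) k l, t = c * a * b := by
  set H : Subgroup (unitTorus n R) := rootKer i j ⊔ rootKer k l
  have hn : 0 < n := i.pos
  have hfg : Group.FG (unitTorus n R) := Group.FG.of_injective (unitTorus n R).subtype
    Subtype.val_injective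
  have : Finite (unitTorus n R ⧸ H) := by
    refine CommGroup.finite_of_fg_isMulTorsion _ fun x => ?_
    obtain ⟨t, rfl⟩ := QuotientGroup.mk_surjective x
    rw [isOfFinOrder_iff_pow_eq_one]
    refine ⟨n, hn, ?_⟩
    rw [← QuotientGroup.mk_pow]
    exact (QuotientGroup.eq_one_iff _).mpr (pow_mem_rootKer_sup hij hkl hlk t)
  refine ⟨Set.range fun x : unitTorus n R ⧸ H => x.out, Set.finite_range _, fun t => ?_⟩
  have ht : ((t : unitTorus n R ⧸ H).out)⁻¹ * t ∈ H := by
    rw [← QuotientGroup.eq, QuotientGroup.out_eq']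
  obtain ⟨a, ha, b, hb, hab⟩ := Subgroup.mem_sup.mp ht
  exact ⟨_, ⟨_, rfl⟩, a, ha, b, hb, by rw [mul_assoc, hab, mul_inv_cancel_left]⟩

end ElementaryMatrices

section BlockUpper

open Matrix

variable {n : ℕ} {R : Type*} [CommRing R]

variable (R) in
/-- The matrices in `SL_n(R)` that, together with their inverses, are block upper triangular
with respect to the level function `lvl`. -/
def blockUpper (lvl : Fin n → ℕ) : Subgroup (Matrix.SpecialLinearGroup (Fin n) R) where
  carrier := {g | ∀ i j, lvl j < lvl i → g i j = 0 ∧ g⁻¹ i j = 0}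
  mul_mem' := by
    intro g h hg hh i j hij
    have key {A B : Matrix.SpecialLinearGroup (Fin n) R}
        (hA : ∀ i j, lvl j < lvl i → A i j = 0) (hB : ∀ i j, lvl j < lvl i → B i j = 0) :
        (A * B) i j = 0 := by
      rw [Matrix.SpecialLinearGroup.coe_mul, mul_apply]
      refine Finset.sum_eq_zero fun k _ => ?_
      rcases lt_or_ge (lvl k) (lvl i) with hk | hk
      · rw [hA i k hk, zero_mul]
      · rw [hB k j (hij.trans_le hk), mul_zero]
    refine ⟨key (fun i j h => (hg i j h).1) (fun i j h => (hh i j h).1), ?_⟩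
    rw [_root_.mul_inv_rev]
    exact key (fun i j h => (hh i j h).2) (fun i j h => (hg i j h).2)
  one_mem' := by
    intro i j hij
    have : i ≠ j := fun h => hij.ne (by rw [h])
    rw [inv_one]
    exact ⟨one_apply_ne this, one_apply_ne this⟩
  inv_mem' := by
    intro g hg i j hij
    rw [inv_inv]
    exact (hg i j hij).symm

theorem blockUpper_apply {lvl : Fin n → ℕ} {g : Matrix.SpecialLinearGroup (Fin n) R}
    (hg : g ∈ blockUpper R lvl) {i j : Fin n} (hij : lvl j < lvl i) : g i j = 0 :=
  (hg i j hij).1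

theorem elem_mem_blockUpper {lvl : Fin n → ℕ} {i j : Fin n} (h : lvl i ≤ lvl j) (r : R) :
    elem i j r ∈ blockUpper R lvl := by
  by_cases hij : i = j
  · rw [elem, dif_neg (not_not.mpr hij)]
    exact one_mem _
  · intro a b hab
    have h1 : a ≠ b := fun h => hab.ne (by rw [h])
    have h2 : ¬ (i = a ∧ j = b) := by
      rintro ⟨rfl, rfl⟩
      omega
    rw [← elem_neg, coe_elem hij, coe_elem hij]
    simp [one_apply_ne h1, single_apply_of_ne _ _ _ _ _ h2]

theorem torusMat_mem_blockUpper (lvl : Fin n → ℕ) (t : unitTorus n R) :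
    torusMat n R t ∈ blockUpper R lvl := by
  intro i j hij
  have : i ≠ j := fun h => hij.ne (by rw [h])
  rw [← map_inv, coe_torusMat, coe_torusMat, diagonal_apply_ne _ this, diagonal_apply_ne _ this]
  exact ⟨rfl, rfl⟩

/-- The block diagonal part of a block upper triangular matrix. -/
def levelDiag (lvl : Fin n → ℕ) : blockUpper R lvl →* Matrix (Fin n) (Fin n) R where
  toFun g := of fun i j => if lvl i = lvl j then g.1 i j else 0
  map_one' := by
    ext i j
    by_cases h : i = j
    · subst h
      exact if_pos rfl
    · simp [one_apply_ne h]
  map_mul' g h := by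
    ext i j
    rw [mul_apply, of_apply]
    split_ifs with hij
    · rw [Subgroup.coe_mul, Matrix.SpecialLinearGroup.coe_mul, mul_apply]
      refine Finset.sum_congr rfl fun k _ => ?_
      rw [of_apply, of_apply]
      rcases lt_trichotomy (lvl k) (lvl i) with hk | hk | hk
      · rw [blockUpper_apply g.2 hk, if_neg hk.ne', zero_mul, zero_mul]
      · rw [if_pos hk.symm, if_pos (hk.trans hij)]
      · rw [blockUpper_apply h.2 (hij ▸ hk), if_neg hk.ne, zero_mul, mul_zero]
    · refine (Finset.sum_eq_zero fun k _ => ?_).symm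
      rw [of_apply, of_apply]
      split_ifs with h1 h2
      · exact absurd (h1.trans h2) hij
      all_goals simp

theorem levelDiag_apply {lvl : Fin n → ℕ} (g : blockUpper R lvl) (i j : Fin n) :
    levelDiag lvl g i j = if lvl i = lvl j then g.1 i j else 0 := rfl

end BlockUpper

section Borel

open Matrix

variable {R : Type*} [CommRing R]

theorem parabolic_empty_le_blockUpper (n : ℕ) :
    parabolic n R ∅ ≤ blockUpper R (fun i : Fin n => i.val) := by
  rw [parabolic, Subgroup.closure_le]
  rintro g ((hg | ⟨i, j, h, r, rfl⟩) | ⟨i, j, h, r, hc, rfl⟩)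
  · obtain ⟨t, rfl⟩ := (mem_diagMats_iff g).mp hg
    exact torusMat_mem_blockUpper _ t
  · rw [← elem_of_ne]
    exact elem_mem_blockUpper (Fin.le_def.mp h.le) r
  · exact absurd (hc (i.val + 1) le_rfl h) (Set.notMem_empty _)

/-- A diagonal entry of an upper triangular matrix, as a homomorphism. -/
def borelDiag {n : ℕ} (i : Fin n) : parabolic n R ∅ →* R where
  toFun g := levelDiag _ (Subgroup.inclusion (parabolic_empty_le_blockUpper n) g) i i
  map_one' := by simp
  map_mul' g h := by
    rw [map_mul, map_mul, mul_apply]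
    refine Finset.sum_eq_single i (fun k _ hk => ?_) (by simp)
    rw [levelDiag_apply, if_neg (fun h => hk (Fin.ext h.symm)), zero_mul]

theorem borelDiag_apply {n : ℕ} (i : Fin n) (g : parabolic n R ∅) : borelDiag i g = g.1 i i := by
  simp [borelDiag, levelDiag_apply]

theorem torusMat_mem_parabolic {n : ℕ} (I : Set ℕ) (t : unitTorus n R) :
    torusMat n R t ∈ parabolic n R I :=
  Subgroup.subset_closure (Or.inl (Or.inl ((mem_diagMats_iff _).mpr ⟨t, rfl⟩)))

theorem units_fg_of_borel_fg {n : ℕ} (hn : 2 ≤ n) (h : Group.FG (parabolic n R ∅)) :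
    Group.FG Rˣ := by
  obtain ⟨m, rfl⟩ := Nat.exists_eq_add_of_le' hn
  refine Group.fg_of_surjective (f := MonoidHom.toHomUnits (borelDiag (R := R) (0 : Fin (m + 2))))
    fun u => ?_
  let t : unitTorus (m + 2) R := ⟨Pi.mulSingle 0 u * Pi.mulSingle 1 u⁻¹, by
    rw [mem_unitTorus]
    simp [Finset.prod_mul_distrib]⟩
  refine ⟨⟨torusMat _ _ t, torusMat_mem_parabolic _ t⟩, ?_⟩
  ext
  rw [MonoidHom.coe_toHomUnits, borelDiag_apply, coe_torusMat, diagonal_apply_eq]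
  simp [t]

theorem exists_finset_units_span_of_borel_fg {n : ℕ} (hn : 2 ≤ n)
    (h : Group.FG (parabolic n R ∅)) :
    ∃ Γ : Finset R, ∀ r : R,
      r ∈ AddSubgroup.closure {x | ∃ (u : Rˣ) (g : Γ), x = (u : R) * g} := by
  classical
  obtain ⟨m, rfl⟩ := Nat.exists_eq_add_of_le' hn
  obtain ⟨S, hS, hSfin⟩ := Group.fg_iff.mp h
  set Γ := hSfin.toFinset.image fun g => g.1 0 1
  set K := AddSubgroup.closure {x | ∃ (u : Rˣ) (g : Γ), x = (u : R) * g} with hK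
  have hunit {u r : R} (hu : IsUnit u) (hr : r ∈ K) : u * r ∈ K := by
    obtain ⟨u, rfl⟩ := hu
    have : K ≤ K.comap (AddMonoidHom.mulLeft (u : R)) := by
      rw [hK, AddSubgroup.closure_le]
      rintro _ ⟨v, g, rfl⟩
      exact AddSubgroup.subset_closure ⟨u * v, g, by simp [mul_assoc]⟩
    exact this hr
  have hd (i : Fin (m + 2)) (g : parabolic (m + 2) R ∅) : IsUnit (g.1 i i) :=
    borelDiag_apply i g ▸ (MonoidHom.toHomUnits (borelDiag i) g).isUnit
  have hmul (g k : parabolic (m + 2) R ∅) :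
      (g * k).1 0 1 = g.1 0 0 * k.1 0 1 + k.1 1 1 * g.1 0 1 := by
    rw [Subgroup.coe_mul, Matrix.SpecialLinearGroup.coe_mul, mul_apply, Fin.sum_univ_succ,
      Fin.sum_univ_succ, Finset.sum_eq_zero, add_zero, mul_comm (k.1 1 1)]
    · rfl
    · intro l _
      rw [blockUpper_apply (parabolic_empty_le_blockUpper _ k.2) (by simp [Fin.val_succ]), mul_zero]
  have hall (g : parabolic (m + 2) R ∅) : g.1 0 1 ∈ K := by
    have hg : g ∈ Subgroup.closure S := hS ▸ Subgroup.mem_top g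
    induction hg using Subgroup.closure_induction with
    | mem x hx =>
      exact AddSubgroup.subset_closure ⟨1, ⟨x.1 0 1, Finset.mem_image_of_mem
        (fun g => g.1 0 1) (hSfin.mem_toFinset.mpr hx)⟩, by simp⟩
    | one => 
      have : ((1 : parabolic (m + 2) R ∅).1 0 1 : R) = 0 := one_apply_ne (by simp)
      rw [this]
      exact K.zero_mem
    | mul g k _ _ ihg ihk =>
      rw [hmul]
      exact K.add_mem (hunit (hd 0 g) ihk) (hunit (hd 1 k) ihg)
    | inv g _ ih =>
      have h0 := hmul g g⁻¹
      have : ((g * g⁻¹).1 0 1 : R) = 0 := by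
        rw [mul_inv_cancel]
        exact one_apply_ne (by simp)
      rw [this] at h0
      obtain ⟨u, hu⟩ := hd 0 g
      rw [← hu] at h0
      have h1 : g⁻¹.1 0 1 = ((u⁻¹ : Rˣ) : R) * -(g⁻¹.1 1 1 * g.1 0 1) := by
        rw [neg_eq_of_add_eq_zero_left h0.symm, Units.inv_mul_cancel_left]
      rw [h1]
      exact hunit (Units.isUnit _) (K.neg_mem (hunit (hd 1 _) ih))
  refine ⟨Γ, fun r => ?_⟩
  have h01 : (0 : Fin (m + 2)) < 1 := by simp
  have := hall ⟨elem 0 1 r, Subgroup.subset_closure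
    (Or.inl (Or.inr ⟨0, 1, h01, r, elem_of_ne h01.ne r⟩))⟩
  rwa [elem_apply_same h01.ne] at this

end Borel

/-- A set `rel` of roots of `SL_n` closed under addition, together with a monotone level function
such that `rel` contains all the level-raising pairs and no level-lowering ones, and every
level-raising pair is a sum of two members of `rel`. -/
structure LevelledRoots (n : ℕ) where
  /-- The level of an index. -/
  lvl : Fin n → ℕ
  /-- The roots. -/
  rel : Fin n → Fin n → Prop
  mono : Monotone lvl
  ne_of_rel : ∀ {i j}, rel i j → i ≠ j
  le_of_rel : ∀ {i j}, rel i j → lvl i ≤ lvl j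
  rel_of_lt : ∀ {i j}, lvl i < lvl j → rel i j
  trans : ∀ {i j l}, rel i j → rel j l → i ≠ l → rel i l
  exists_mid : ∀ {i j}, lvl i < lvl j → ∃ k, rel i k ∧ rel k j

namespace LevelledRoots

variable {n : ℕ} (D : LevelledRoots n) (R : Type*) [CommRing R]

/-- The parabolic subgroup generated by the torus and the root subgroups of `D`. -/
def par : Subgroup (Matrix.SpecialLinearGroup (Fin n) R) :=
  Subgroup.closure (Set.range (torusMat n R) ∪ {g | ∃ i j r, D.rel i j ∧ g = elem i j r})

/-- The subgroup generated by the torus and the level-preserving root subgroups of `D`. -/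
def core : Subgroup (Matrix.SpecialLinearGroup (Fin n) R) :=
  Subgroup.closure (Set.range (torusMat n R) ∪
    {g | ∃ i j r, D.rel i j ∧ D.lvl i = D.lvl j ∧ g = elem i j r})

variable {R}

theorem core_le_par : D.core R ≤ D.par R :=
  Subgroup.closure_mono (Set.union_subset_union_right _
    fun _ ⟨i, j, r, h, _, hg⟩ => ⟨i, j, r, h, hg⟩)

theorem torusMat_mem_core (t : unitTorus n R) : torusMat n R t ∈ D.core R :=
  Subgroup.subset_closure (Or.inl ⟨t, rfl⟩)

theorem elem_mem_core {i j : Fin n} (h : D.rel i j) (hl : D.lvl i = D.lvl j) (r : R) :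
    elem i j r ∈ D.core R :=
  Subgroup.subset_closure (Or.inr ⟨i, j, r, h, hl, rfl⟩)

theorem elem_mem_par {i j : Fin n} (h : D.rel i j) (r : R) : elem i j r ∈ D.par R :=
  Subgroup.subset_closure (Or.inr ⟨i, j, r, h, rfl⟩)

theorem par_le_blockUpper : D.par R ≤ blockUpper R D.lvl := by
  rw [par, Subgroup.closure_le]
  rintro _ (⟨t, rfl⟩ | ⟨i, j, r, h, rfl⟩)
  · exact torusMat_mem_blockUpper _ t
  · exact elem_mem_blockUpper (D.le_of_rel h) r

/-- The inclusion of the core in the group of block upper triangular matrices. -/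
def coreIncl : D.core R →* blockUpper R D.lvl :=
  Subgroup.inclusion (D.core_le_par.trans D.par_le_blockUpper)

theorem levelDiag_coreIncl (l : D.core R) : levelDiag D.lvl (D.coreIncl l) = l.1.1 := by
  have key : (levelDiag D.lvl).comp D.coreIncl =
      Matrix.SpecialLinearGroup.coeMonoidHom.comp (D.core R).subtype := by
    refine MonoidHom.eq_of_eqOn_dense Subgroup.closure_closure_coe_preimage ?_
    intro g hg
    change levelDiag D.lvl (D.coreIncl g) = g.1.1
    suffices h : ∀ a b, D.lvl a ≠ D.lvl b → g.1 a b = 0 by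
      ext a b
      rw [levelDiag_apply]
      split_ifs with hab
      · rfl
      · exact (h a b hab).symm
    intro a b hab
    have hne : a ≠ b := fun h => hab (by rw [h])
    rcases hg with ⟨t, ht⟩ | ⟨i, j, r, hij, hl, hg⟩
    · rw [← ht, coe_torusMat, Matrix.diagonal_apply_ne _ hne]
    · have : ¬ (i = a ∧ j = b) := by
        rintro ⟨rfl, rfl⟩
        exact hab hl
      rw [hg, coe_elem (D.ne_of_rel hij), Matrix.add_apply, Matrix.one_apply_ne hne,
        Matrix.single_apply_of_ne _ _ _ _ _ this, add_zero]
  exact DFunLike.congr_fun key l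

theorem exists_core_eq_levelDiag (g : D.par R) :
    ∃ l : D.core R, levelDiag D.lvl (Subgroup.inclusion D.par_le_blockUpper g) = l.1.1 := by
  obtain ⟨g, hg⟩ := g
  induction hg using Subgroup.closure_induction with
  | mem x hx =>
    rcases hx with ⟨t, rfl⟩ | ⟨i, j, r, hij, rfl⟩
    · exact ⟨⟨_, D.torusMat_mem_core t⟩, D.levelDiag_coreIncl ⟨_, D.torusMat_mem_core t⟩⟩
    · by_cases hl : D.lvl i = D.lvl j
      · exact ⟨⟨_, D.elem_mem_core hij hl r⟩, D.levelDiag_coreIncl ⟨_, D.elem_mem_core hij hl r⟩⟩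
      · refine ⟨1, ?_⟩
        ext a b
        rw [levelDiag_apply]
        split_ifs with hab
        · have : ¬ (i = a ∧ j = b) := by
            rintro ⟨rfl, rfl⟩
            exact hl hab
          change elem i j r a b = (1 : Matrix (Fin n) (Fin n) R) a b
          rw [coe_elem (D.ne_of_rel hij), Matrix.add_apply,
            Matrix.single_apply_of_ne _ _ _ _ _ this, add_zero]
        · exact (Matrix.one_apply_ne fun h => hab (by rw [h])).symm
  | one => exact ⟨1, map_one ((levelDiag D.lvl).comp (Subgroup.inclusion D.par_le_blockUpper))⟩
  | mul x y hx hy ihx ihy =>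
    obtain ⟨l, hl⟩ := ihx
    obtain ⟨m, hm⟩ := ihy
    refine ⟨l * m, ?_⟩
    have := map_mul ((levelDiag D.lvl).comp (Subgroup.inclusion D.par_le_blockUpper))
      ⟨x, hx⟩ ⟨y, hy⟩
    simp only [MonoidHom.comp_apply] at this
    rw [hl, hm] at this
    exact this
  | inv x hx ihx =>
    obtain ⟨l, hl⟩ := ihx
    refine ⟨l⁻¹, left_inv_eq_right_inv (a := l.1.1) ?_ ?_⟩
    · rw [← hl, ← map_mul, ← map_mul]
      have : (⟨x⁻¹, inv_mem hx⟩ : D.par R) * ⟨x, hx⟩ = 1 := inv_mul_cancel (⟨x, hx⟩ : D.par R)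
      rw [this, map_one, map_one]
    · exact congrArg Subtype.val (mul_inv_cancel l.1)

/-- The retraction of `D.par R` onto `D.core R`. -/
noncomputable def retraction : D.par R →* D.core R where
  toFun g := (D.exists_core_eq_levelDiag g).choose
  map_one' := by
    apply Subtype.ext
    apply Subtype.ext
    rw [← (D.exists_core_eq_levelDiag 1).choose_spec, map_one, map_one]
    rfl
  map_mul' g h := by
    apply Subtype.ext
    apply Subtype.ext
    rw [← (D.exists_core_eq_levelDiag (g * h)).choose_spec, map_mul, map_mul]
    exact congrArg₂ (· * ·) (D.exists_core_eq_levelDiag g).choose_spec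
      (D.exists_core_eq_levelDiag h).choose_spec

theorem retraction_inclusion (l : D.core R) :
    D.retraction (Subgroup.inclusion D.core_le_par l) = l := by
  apply Subtype.ext
  apply Subtype.ext
  exact (D.exists_core_eq_levelDiag _).choose_spec.symm.trans (D.levelDiag_coreIncl l)

theorem core_isFinitelyPresented_of_par [Group.IsFinitelyPresented (D.par R)] :
    Group.IsFinitelyPresented (D.core R) :=
  Group.IsFinitelyPresented.of_retract D.retraction (Subgroup.inclusion D.core_le_par)
    D.retraction_inclusion

end LevelledRoots

section Commutators

open scoped commutatorElement

theorem commutator_mem_of_mem_closure {G : Type*} [Group G] {S T : Set G} {W : Subgroup G}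
    (h : ∀ a ∈ S, ∀ b ∈ T, ⁅a, b⁆ ∈ W) (hS : ∀ a ∈ S, ∀ w ∈ W, Commute a w)
    (hT : ∀ b ∈ T, ∀ w ∈ W, Commute b w) {a b : G} (ha : a ∈ Subgroup.closure S)
    (hb : b ∈ Subgroup.closure T) : ⁅a, b⁆ ∈ W := by
  have hcl {S : Set G} (hS : ∀ a ∈ S, ∀ w ∈ W, Commute a w) {a : G}
      (ha : a ∈ Subgroup.closure S) : ∀ w ∈ W, Commute a w := by
    have : Subgroup.closure S ≤ Subgroup.centralizer (W : Set G) := by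
      rw [Subgroup.closure_le]
      exact fun a ha w hw => (hS a ha w hw).symm
    exact fun w hw => (this ha w hw).symm
  have hleft {S : Set G} (hS : ∀ a ∈ S, ∀ w ∈ W, Commute a w) {b : G} (h : ∀ a ∈ S, ⁅a, b⁆ ∈ W)
      {a : G} (ha : a ∈ Subgroup.closure S) : ⁅a, b⁆ ∈ W := by
    induction ha using Subgroup.closure_induction with
    | mem x hx => exact h x hx
    | one => rw [commutatorElement_one_left]; exact W.one_mem
    | mul x y hx hy ihx ihy =>
      have : ⁅x * y, b⁆ = x * ⁅y, b⁆ * x⁻¹ * ⁅x, b⁆ := by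
        simp only [commutatorElement_def]
        group
      rw [this, (hcl hS hx _ ihy).eq, mul_inv_cancel_right]
      exact W.mul_mem ihy ihx
    | inv x hx ihx =>
      have : ⁅x⁻¹, b⁆ = x⁻¹ * ⁅x, b⁆⁻¹ * x := by
        simp only [commutatorElement_def]
        group
      rw [this, mul_assoc, ← (hcl hS hx _ (W.inv_mem ihx)).eq, inv_mul_cancel_left]
      exact W.inv_mem ihx
  refine hleft hS (fun a ha => ?_) ha
  rw [← commutatorElement_inv]
  refine W.inv_mem (hleft hT (fun b hb => ?_) hb)
  rw [← commutatorElement_inv]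
  exact W.inv_mem (h a ha b hb)

theorem commutator_conj_mem {T G : Type*} [CommGroup T] [Group G] (s : T →* G) {W : Subgroup G}
    (hW : ∀ t, ∀ w ∈ W, s t * w * (s t)⁻¹ ∈ W) {A B : Subgroup T} {C : Set T}
    (hC : ∀ t, ∃ c ∈ C, ∃ a ∈ A, ∃ b ∈ B, t = c * a * b) {x z : G}
    (hA : ∀ a ∈ A, Commute (s a) x) (hB : ∀ b ∈ B, Commute (s b) z)
    (h : ∀ c ∈ C, ⁅s c * x * (s c)⁻¹, z⁆ ∈ W) (t u : T) :
    ⁅s t * x * (s t)⁻¹, s u * z * (s u)⁻¹⁆ ∈ W := by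
  obtain ⟨c, hc, a, ha, b, hb, htu⟩ := hC (u⁻¹ * t)
  have ht : t = u * b * c * a := by
    rw [inv_mul_eq_iff_eq_mul.mp htu]
    simp only [mul_assoc]
    rw [mul_left_comm b c a, mul_comm b a]
  have hx : s t * x * (s t)⁻¹ = s (u * b) * (s c * x * (s c)⁻¹) * (s (u * b))⁻¹ := by
    rw [ht, map_mul _ (u * b * c) a, map_mul _ (u * b) c, mul_assoc _ (s a) x, (hA a ha).eq]
    group
  have hz : s u * z * (s u)⁻¹ = s (u * b) * z * (s (u * b))⁻¹ := by
    rw [map_mul, mul_assoc _ (s b) z, (hB b hb).eq]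
    group
  rw [hx, hz, ← conjugate_commutatorElement]
  exact hW _ _ (h c hc)

end Commutators

namespace LevelledRoots

open scoped commutatorElement

/-- The Steinberg type relations between the root subgroups of `D`. -/
structure Rels {n : ℕ} (D : LevelledRoots n) {R G Γ : Type*} [CommRing R] [Group G]
    (s : unitTorus n R →* G) (y : Fin n → Fin n → Γ → G) : Prop where
  comm : ∀ {i j k l}, D.rel i j → D.rel k l → (i, j) ≠ (k, l) → i ≠ l → ∀ t u g h,
    ⁅s t * y i j g * (s t)⁻¹, s u * y k l h * (s u)⁻¹⁆ ∈
      (if j = k then conjSpan s (y i l) else ⊥ : Subgroup G)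
  mid : ∀ {i j}, D.lvl i < D.lvl j → ∀ g, ∃ k h, D.rel i k ∧ D.rel k j ∧
    y i j g = ⁅y i k g, y k j h⁆

namespace Rels

variable {n : ℕ} {D : LevelledRoots n} {R G Γ : Type*} [CommRing R] [Group G]
  {s : unitTorus n R →* G} {y : Fin n → Fin n → Γ → G}

theorem commute (hD : D.Rels s y) {i j k l : Fin n} (hij : D.rel i j) (hkl : D.rel k l)
    (hne : (i, j) ≠ (k, l)) (hil : i ≠ l) (hjk : j ≠ k) {a b : G} (ha : a ∈ conjSpan s (y i j))
    (hb : b ∈ conjSpan s (y k l)) : Commute a b := by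
  rw [← commutatorElement_eq_one_iff_commute, ← Subgroup.mem_bot]
  refine commutator_mem_of_mem_closure ?_ ?_ ?_ ha hb
  · rintro _ ⟨t, g, rfl⟩ _ ⟨u, h, rfl⟩
    simpa only [if_neg hjk] using hD.comm hij hkl hne hil t u g h
  all_goals
    rintro a - w hw
    rw [Subgroup.mem_bot.mp hw]
    exact Commute.one_right a

theorem commutator_mem (hD : D.Rels s y) {i j l : Fin n} (hij : D.rel i j) (hjl : D.rel j l)
    (hil : i ≠ l) {a b : G} (ha : a ∈ conjSpan s (y i j)) (hb : b ∈ conjSpan s (y j l)) :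
    ⁅a, b⁆ ∈ conjSpan s (y i l) := by
  have h := D.trans hij hjl hil
  refine commutator_mem_of_mem_closure ?_ ?_ ?_ ha hb
  · rintro _ ⟨t, g, rfl⟩ _ ⟨u, h, rfl⟩
    simpa using hD.comm hij hjl (by simp [D.ne_of_rel hij]) hil t u g h
  · exact fun a ha w hw => hD.commute hij h (by simp [D.ne_of_rel hjl]) hil
      (D.ne_of_rel hij).symm (Subgroup.subset_closure ha) hw
  · exact fun a ha w hw => hD.commute hjl h (by simp [(D.ne_of_rel hij).symm]) (D.ne_of_rel hjl)
      hil.symm (Subgroup.subset_closure ha) hw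

theorem commute_self (hD : D.Rels s y) {i j : Fin n} (hij : D.lvl i < D.lvl j) {a b : G}
    (ha : a ∈ conjSpan s (y i j)) (hb : b ∈ conjSpan s (y i j)) : Commute a b := by
  have hr := D.rel_of_lt hij
  have : conjSpan s (y i j) ≤ Subgroup.centralizer {b} := by
    refine conjSpan_le fun t g => ?_
    obtain ⟨k, h, hik, hkj, hy⟩ := hD.mid hij g
    rw [hy, conjugate_commutatorElement, commutatorElement_def]
    have h1 : s t * y i k g * (s t)⁻¹ ∈ Subgroup.centralizer {b} := by
      rw [Subgroup.mem_centralizer_singleton_iff]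
      exact hD.commute hik hr (by simp [D.ne_of_rel hkj]) (D.ne_of_rel hr)
        (D.ne_of_rel hik).symm (conj_mem_conjSpan s _ t g) hb
    have h2 : s t * y k j h * (s t)⁻¹ ∈ Subgroup.centralizer {b} := by
      rw [Subgroup.mem_centralizer_singleton_iff]
      exact hD.commute hkj hr (by simp [(D.ne_of_rel hik).symm]) (D.ne_of_rel hkj)
        (D.ne_of_rel hr).symm (conj_mem_conjSpan s _ t h) hb
    exact mul_mem (mul_mem (mul_mem h1 h2) (inv_mem h1)) (inv_mem h2)
  exact Subgroup.mem_centralizer_singleton_iff.mp (this ha)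

end Rels

end LevelledRoots

section RelFilter

variable {G : Type*} [Group G]

/-- The filter on the normal subgroups of `G` generated by the sets of those that contain a given
element of `K`. -/
def relFilter (K : Subgroup G) : Filter {N : Subgroup G // N.Normal} :=
  ⨅ w : K, Filter.principal {N | (w : G) ∈ N.1}

theorem eventually_mem_relFilter {K : Subgroup G} {w : G} (hw : w ∈ K) :
    ∀ᶠ N in relFilter K, w ∈ N.1 :=
  Filter.mem_iInf_of_mem ⟨w, hw⟩ (Filter.mem_principal_self _)

theorem eventually_relFilter_iff {K : Subgroup G} {p : {N : Subgroup G // N.Normal} → Prop} :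
    (∀ᶠ N in relFilter K, p N) ↔
      ∃ S : Set G, S.Finite ∧ S ⊆ K ∧ ∀ N : {N : Subgroup G // N.Normal}, S ⊆ N.1 → p N := by
  constructor
  · intro h
    obtain ⟨S, hS, hp⟩ := (Filter.hasBasis_iInf_principal_finite _).mem_iff.mp h
    refine ⟨(fun w : K => (w : G)) '' S, hS.image _, ?_, fun N hN => hp ?_⟩
    · rintro _ ⟨w, -, rfl⟩
      exact w.2
    · exact Set.mem_iInter₂.mpr fun w hw => hN ⟨w, hw, rfl⟩
  · rintro ⟨S, hS, hSK, hp⟩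
    have := (Filter.eventually_all_finite hS).mpr fun w hw => eventually_mem_relFilter (hSK hw)
    exact this.mono fun N hN => hp N hN

instance (N : {N : Subgroup G // N.Normal}) : N.1.Normal := N.2

theorem eventually_inf_le {K : Subgroup G} [K.Normal] (B : Subgroup G)
    {p : {N : Subgroup G // N.Normal} → Prop} (hp : ∀ᶠ N in relFilter K, p N)
    (h : ∀ N, p N → N.1 ≤ K → ∃ F : Set (G ⧸ N.1), F.Finite ∧
      F ⊆ (B ⊓ K).map (QuotientGroup.mk' N.1) ∧
      (B ⊓ K).map (QuotientGroup.mk' N.1) ≤ Subgroup.normalClosure F) :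
    ∀ᶠ N in relFilter K, B ⊓ K ≤ N.1 := by
  obtain ⟨S, hS, hSK, hpS⟩ := eventually_relFilter_iff.mp hp
  set N₁ : {N : Subgroup G // N.Normal} := ⟨Subgroup.normalClosure S, inferInstance⟩
  obtain ⟨F, hF, hFB, hBF⟩ := h N₁ (hpS _ Subgroup.subset_normalClosure)
    (Subgroup.normalClosure_le_normal hSK)
  have hFB' : ∀ x ∈ F, ∃ c ∈ B ⊓ K, QuotientGroup.mk' N₁.1 c = x := hFB
  choose! c hcB hc using hFB'
  refine eventually_relFilter_iff.mpr ⟨S ∪ c '' F, hS.union (hF.image _), ?_, fun N hN => ?_⟩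
  · refine Set.union_subset hSK ?_
    rintro _ ⟨x, hx, rfl⟩
    exact (hcB x hx).2
  · intro b hb
    have hN₁ : N₁.1 ≤ N.1 :=
      Subgroup.normalClosure_le_normal (Set.subset_union_left.trans hN)
    have : (N.1.map (QuotientGroup.mk' N₁.1)).Normal :=
      Subgroup.Normal.map N.2 _ (QuotientGroup.mk'_surjective _)
    have hle : Subgroup.normalClosure F ≤ N.1.map (QuotientGroup.mk' N₁.1) :=
      Subgroup.normalClosure_le_normal fun x hx => ⟨c x, hN (Or.inr ⟨x, hx, rfl⟩), hc x hx⟩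
    obtain ⟨m, hm, hmb⟩ := hle (hBF ⟨b, hb, rfl⟩)
    have := hN₁ (QuotientGroup.eq.mp hmb)
    simpa using N.1.mul_mem hm this

end RelFilter

namespace LevelledRoots

open scoped commutatorElement

/-- The torus as a subgroup of the core. -/
def coreTorus {n : ℕ} (D : LevelledRoots n) (R : Type*) [CommRing R] :
    unitTorus n R →* D.core R :=
  (torusMat n R).codRestrict _ D.torusMat_mem_core

/-- A group mapping to `SL_n(R)`, generated by a copy of the core and by preimages of the
level-raising elementary matrices with entries in the family `γ`. -/
structure Model {n : ℕ} (D : LevelledRoots n) {R Γ : Type*} [CommRing R] (γ : Γ → R)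
    (Q : Type*) [Group Q] where
  /-- The copy of the core. -/
  ofCore : D.core R →* Q
  /-- The generators. -/
  gen : Fin n → Fin n → Γ → Q
  /-- The map to matrices. -/
  toMat : Q →* Matrix.SpecialLinearGroup (Fin n) R
  toMat_ofCore : ∀ l, toMat (ofCore l) = l
  toMat_gen : ∀ {i j}, D.rel i j → ∀ g, toMat (gen i j g) = elem i j (γ g)
  gen_eq : ∀ {i j} (h : D.rel i j) (hl : D.lvl i = D.lvl j) g,
    gen i j g = ofCore ⟨elem i j (γ g), D.elem_mem_core h hl _⟩
  closure_eq_top : Subgroup.closure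
    (Set.range ofCore ∪ {x | ∃ i j g, D.lvl i < D.lvl j ∧ x = gen i j g}) = ⊤

namespace Model

variable {n : ℕ} {D : LevelledRoots n} {R Γ : Type*} [CommRing R] {γ : Γ → R}
  {Q : Type*} [Group Q] (M : D.Model γ Q)

/-- The torus in a model. -/
def torus : unitTorus n R →* Q := M.ofCore.comp (D.coreTorus R)

theorem toMat_torus (t : unitTorus n R) : M.toMat (M.torus t) = torusMat n R t :=
  M.toMat_ofCore _

/-- The root subgroups of a model. -/
def root (i j : Fin n) : Subgroup Q := conjSpan M.torus (M.gen i j)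

theorem toMat_conj_gen {i j : Fin n} (h : D.rel i j) (t : unitTorus n R) (g : Γ) :
    M.toMat (M.torus t * M.gen i j g * (M.torus t)⁻¹) =
      elem i j (((t.1 i / t.1 j : Rˣ) : R) * γ g) := by
  rw [map_mul, map_mul, map_inv, toMat_torus, M.toMat_gen h, torusMat_conj_elem]

theorem exists_toMat_eq_elem (hn : 3 ≤ n)
    (hγ : ∀ r : R, r ∈ AddSubgroup.closure {x | ∃ (u : Rˣ) (g : Γ), x = (u : R) * γ g})
    {i j : Fin n} (h : D.rel i j) (r : R) : ∃ v ∈ M.root i j, M.toMat v = elem i j r := by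
  induction hγ r using AddSubgroup.closure_induction with
  | mem x hx =>
    obtain ⟨u, g, rfl⟩ := hx
    obtain ⟨t, ht⟩ := exists_unitTorus_div_eq hn (D.ne_of_rel h) u
    exact ⟨_, conj_mem_conjSpan _ _ t g, by rw [toMat_conj_gen M h, ht]⟩
  | zero => exact ⟨1, one_mem _, by rw [map_one, elem_zero]⟩
  | add x y _ _ ihx ihy =>
    obtain ⟨v, hv, hvx⟩ := ihx
    obtain ⟨w, hw, hwy⟩ := ihy
    exact ⟨v * w, mul_mem hv hw, by rw [map_mul, hvx, hwy, elem_add]⟩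
  | neg x _ ihx =>
    obtain ⟨v, hv, hvx⟩ := ihx
    exact ⟨v⁻¹, inv_mem hv, by rw [map_inv, hvx, elem_neg]⟩

theorem toMat_of_mem_root {i j : Fin n} (h : D.rel i j) {v : Q} (hv : v ∈ M.root i j) :
    ∃ r, M.toMat v = elem i j r := by
  induction hv using Subgroup.closure_induction with
  | mem x hx =>
    obtain ⟨t, g, rfl⟩ := hx
    exact ⟨_, M.toMat_conj_gen h t g⟩
  | one => exact ⟨0, by rw [map_one, elem_zero]⟩
  | mul x y _ _ ihx ihy =>
    obtain ⟨r, hr⟩ := ihx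
    obtain ⟨s, hs⟩ := ihy
    exact ⟨r + s, by rw [map_mul, hr, hs, elem_add]⟩
  | inv x _ ihx =>
    obtain ⟨r, hr⟩ := ihx
    exact ⟨-r, by rw [map_inv, hr, elem_neg]⟩

/-- The image in `Q ⧸ N` of the torus. -/
abbrev quotTorus (N : {N : Subgroup Q // N.Normal}) : unitTorus n R →* Q ⧸ N.1 :=
  (QuotientGroup.mk' N.1).comp M.torus

/-- The images in `Q ⧸ N` of the generators. -/
abbrev quotGen (N : {N : Subgroup Q // N.Normal}) (i j : Fin n) : Γ → Q ⧸ N.1 :=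
  QuotientGroup.mk' N.1 ∘ M.gen i j

theorem root_map_quot (N : {N : Subgroup Q // N.Normal}) (i j : Fin n) :
    (M.root i j).map (QuotientGroup.mk' N.1) = conjSpan (M.quotTorus N) (M.quotGen N i j) :=
  conjSpan_map _ _ _

theorem eventually_commute_rootKer [Group.FG Rˣ] [Finite Γ] {i j : Fin n} (h : D.rel i j) :
    ∀ᶠ N in relFilter M.toMat.ker, ∀ a ∈ rootKer (R := R) i j, ∀ g,
      Commute (M.quotTorus N a) (M.quotGen N i j g) := by
  have : Group.FG (rootKer (R := R) i j) := unitTorus_fg _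
  obtain ⟨S, hS, hSfin⟩ := (Subgroup.fg_iff _).mp ((Group.fg_iff_subgroup_fg _).mp this)
  have key : ∀ᶠ N in relFilter M.toMat.ker, ∀ a ∈ S, ∀ g,
      ⁅M.torus a, M.gen i j g⁆ ∈ N.1 := by
    refine (Filter.eventually_all_finite hSfin).mpr fun a ha => Filter.eventually_all.mpr fun g =>
      eventually_mem_relFilter ?_
    have ha' : a ∈ rootKer (R := R) i j := hS ▸ Subgroup.subset_closure ha
    rw [mem_rootKer] at ha'
    rw [MonoidHom.mem_ker, map_commutatorElement, commutatorElement_eq_one_iff_commute,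
      toMat_torus, M.toMat_gen h]
    have := torusMat_conj_elem a i j (γ g)
    rw [ha', div_self', Units.val_one, one_mul, mul_inv_eq_iff_eq_mul] at this
    exact this
  refine key.mono fun N hN a ha g => ?_
  have hle : rootKer (R := R) i j ≤
      (Subgroup.centralizer {M.quotGen N i j g}).comap (M.quotTorus N) := by
    rw [← hS, Subgroup.closure_le]
    intro a ha
    have := (QuotientGroup.eq_one_iff _).mpr (hN a ha g)
    change QuotientGroup.mk' N.1 _ = 1 at this
    rw [map_commutatorElement, commutatorElement_eq_one_iff_commute] at this
    exact Subgroup.mem_centralizer_singleton_iff.mpr this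
  exact Subgroup.mem_centralizer_singleton_iff.mp (hle ha)

theorem eventually_comm [Group.FG Rˣ] [Finite Γ] (hn : 3 ≤ n)
    (hγ : ∀ r : R, r ∈ AddSubgroup.closure {x | ∃ (u : Rˣ) (g : Γ), x = (u : R) * γ g})
    {i j k l : Fin n} (hij : D.rel i j) (hkl : D.rel k l) (hne : (i, j) ≠ (k, l)) (hil : i ≠ l) :
    ∀ᶠ N in relFilter M.toMat.ker, ∀ t u g h,
      ⁅M.quotTorus N t * M.quotGen N i j g * (M.quotTorus N t)⁻¹,
        M.quotTorus N u * M.quotGen N k l h * (M.quotTorus N u)⁻¹⁆ ∈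
      (if j = k then conjSpan (M.quotTorus N) (M.quotGen N i l) else ⊥ : Subgroup (Q ⧸ N.1)) := by
  obtain ⟨C, hCfin, hC⟩ := exists_finite_rootKer_cosets (R := R) (D.ne_of_rel hij) hne
    (by simp [hil])
  have key : ∀ᶠ N in relFilter M.toMat.ker, ∀ c ∈ C, ∀ g h,
      ⁅M.quotTorus N c * M.quotGen N i j g * (M.quotTorus N c)⁻¹, M.quotGen N k l h⁆ ∈
      (if j = k then conjSpan (M.quotTorus N) (M.quotGen N i l) else ⊥ : Subgroup (Q ⧸ N.1)) := by
    refine (Filter.eventually_all_finite hCfin).mpr fun c hc => Filter.eventually_all.mpr fun g =>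
      Filter.eventually_all.mpr fun h => ?_
    have hmat : M.toMat ⁅M.torus c * M.gen i j g * (M.torus c)⁻¹, M.gen k l h⁆ =
        if j = k then elem i l (((c.1 i / c.1 j : Rˣ) : R) * γ g * γ h) else 1 := by
      rw [map_commutatorElement, toMat_conj_gen M hij, M.toMat_gen hkl,
        commutator_elem (D.ne_of_rel hij) (D.ne_of_rel hkl) hil]
    obtain ⟨v, hv, hvm⟩ : ∃ v ∈ (if j = k then M.root i l else ⊥ : Subgroup Q),
        M.toMat ⁅M.torus c * M.gen i j g * (M.torus c)⁻¹, M.gen k l h⁆ = M.toMat v := by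
      rw [hmat]
      split_ifs with hjk
      · subst hjk
        obtain ⟨v, hv, hvm⟩ := M.exists_toMat_eq_elem hn hγ (D.trans hij hkl hil)
          (((c.1 i / c.1 j : Rˣ) : R) * γ g * γ h)
        exact ⟨v, hv, hvm.symm⟩
      · exact ⟨1, one_mem _, (map_one _).symm⟩
    refine (eventually_mem_relFilter (w := v⁻¹ * ⁅_, _⁆) (K := M.toMat.ker)
      (by rw [MonoidHom.mem_ker, map_mul, map_inv, hvm, inv_mul_cancel])).mono fun N hN => ?_
    have h1 := QuotientGroup.eq.mpr hN
    change QuotientGroup.mk' N.1 _ = QuotientGroup.mk' N.1 _ at h1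
    rw [map_commutatorElement, map_mul, map_mul, map_inv] at h1
    refine (congrArg (· ∈ _) h1).mp ?_
    split_ifs with hjk
    · rw [if_pos hjk] at hv
      rw [← root_map_quot]
      exact Subgroup.mem_map_of_mem _ hv
    · rw [if_neg hjk, Subgroup.mem_bot] at hv
      rw [hv, map_one]
      exact one_mem _
  filter_upwards [key, M.eventually_commute_rootKer hij, M.eventually_commute_rootKer hkl]
    with N h h1 h2 t u g g'
  refine commutator_conj_mem (M.quotTorus N) (fun t w hw => ?_) hC (fun a ha => h1 a ha g)
    (fun b hb => h2 b hb g') (fun c hc => h c hc g g') t u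
  split_ifs at hw ⊢
  · exact conjSpan_conj _ _ t hw
  · rw [Subgroup.mem_bot.mp hw]
    simp

theorem eventually_rels [Group.FG Rˣ] [Finite Γ] (hn : 3 ≤ n)
    (hγ : ∀ r : R, r ∈ AddSubgroup.closure {x | ∃ (u : Rˣ) (g : Γ), x = (u : R) * γ g})
    (h1 : ∃ g, γ g = 1) :
    ∀ᶠ N in relFilter M.toMat.ker, D.Rels (M.quotTorus N) (M.quotGen N) := by
  have hcomm : ∀ᶠ N in relFilter M.toMat.ker, ∀ i j k l, D.rel i j → D.rel k l →
      (i, j) ≠ (k, l) → i ≠ l → ∀ t u g h,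
      ⁅M.quotTorus N t * M.quotGen N i j g * (M.quotTorus N t)⁻¹,
        M.quotTorus N u * M.quotGen N k l h * (M.quotTorus N u)⁻¹⁆ ∈
      (if j = k then conjSpan (M.quotTorus N) (M.quotGen N i l)
        else ⊥ : Subgroup (Q ⧸ N.1)) := by
    simp only [Filter.eventually_all]
    exact fun i j k l hij hkl hne hil => by
      simpa only [Filter.eventually_all] using M.eventually_comm hn hγ hij hkl hne hil
  have hmid : ∀ᶠ N in relFilter M.toMat.ker, ∀ i j, D.lvl i < D.lvl j → ∀ g, ∃ k h,
      D.rel i k ∧ D.rel k j ∧ M.quotGen N i j g = ⁅M.quotGen N i k g, M.quotGen N k j h⁆ := by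
    simp only [Filter.eventually_all]
    intro i j hij g
    obtain ⟨k, hik, hkj⟩ := D.exists_mid hij
    obtain ⟨e, he⟩ := h1
    have hr := D.rel_of_lt hij
    refine (eventually_mem_relFilter (w := (M.gen i j g)⁻¹ * ⁅M.gen i k g, M.gen k j e⁆)
      (K := M.toMat.ker) ?_).mono fun N hN => ⟨k, e, hik, hkj, ?_⟩
    · rw [MonoidHom.mem_ker, map_mul, map_inv, map_commutatorElement, M.toMat_gen hr,
        M.toMat_gen hik, M.toMat_gen hkj,
        commutator_elem (D.ne_of_rel hik) (D.ne_of_rel hkj) (D.ne_of_rel hr), if_pos rfl, he,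
        mul_one, inv_mul_cancel]
    · exact (QuotientGroup.eq.mpr hN).trans (map_commutatorElement (QuotientGroup.mk' N.1) _ _)
  filter_upwards [hcomm, hmid] with N h h'
  exact ⟨fun hij hkl hne hil => h _ _ _ _ hij hkl hne hil, fun hij => h' _ _ hij⟩

theorem eventually_root_inf_ker_le [Group.FG Rˣ] [Finite Γ] (hn : 3 ≤ n)
    (hγ : ∀ r : R, r ∈ AddSubgroup.closure {x | ∃ (u : Rˣ) (g : Γ), x = (u : R) * γ g})
    (h1 : ∃ g, γ g = 1) {i j : Fin n} (hij : D.lvl i < D.lvl j) :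
    ∀ᶠ N in relFilter M.toMat.ker, M.root i j ⊓ M.toMat.ker ≤ N.1 := by
  have hfg : Group.FG (unitTorus n R) := Group.FG.of_injective (unitTorus n R).subtype
    Subtype.val_injective
  refine eventually_inf_le _ (M.eventually_rels hn hγ h1) fun N hN hle => ?_
  refine exists_finite_le_normalClosure (M.quotTorus N) (M.quotGen N i j)
    (fun a ha b hb => hN.commute_self hij ha hb) _ ?_ ?_
  · rw [← root_map_quot]
    exact Subgroup.map_mono inf_le_left
  · rintro t _ ⟨a, ha, rfl⟩
    refine ⟨M.torus t * a * (M.torus t)⁻¹, ⟨conjSpan_conj _ _ t ha.1, ?_⟩, ?_⟩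
    · exact Subgroup.Normal.conj_mem inferInstance _ ha.2 _
    · simp

end Model

end LevelledRoots

namespace LevelledRoots

open scoped commutatorElement

theorem Rels.conj_mem {n : ℕ} {D : LevelledRoots n} {R G Γ : Type*} [CommRing R] [Group G]
    {s : unitTorus n R →* G} {y : Fin n → Fin n → Γ → G} (hD : D.Rels s y) {i j k l : Fin n}
    (hij : D.rel i j) (hkl : D.lvl k < D.lvl l) {K : Subgroup G} (hK : conjSpan s (y k l) ≤ K)
    (hjk : j = k → conjSpan s (y i l) ≤ K) (hli : l = i → conjSpan s (y k j) ≤ K)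
    {a b : G} (ha : a ∈ conjSpan s (y i j)) (hb : b ∈ conjSpan s (y k l)) :
    a * b * a⁻¹ ∈ K := by
  have hle := D.le_of_rel hij
  have hr := D.rel_of_lt hkl
  have hmul : a * b * a⁻¹ = ⁅a, b⁆ * b := by
    rw [commutatorElement_def, inv_mul_cancel_right]
  rw [hmul]
  refine K.mul_mem ?_ (hK hb)
  by_cases hjk' : j = k
  · subst hjk'
    have hil : i ≠ l := by
      rintro rfl
      exact absurd hle hkl.not_ge
    exact hjk rfl (hD.commutator_mem hij hr hil ha hb)
  by_cases hli' : l = i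
  · subst hli'
    rw [← commutatorElement_inv]
    exact K.inv_mem (hli rfl (hD.commutator_mem hr hij (Ne.symm hjk') hb ha))
  have hcomm : Commute a b := by
    by_cases he : (i, j) = (k, l)
    · obtain ⟨rfl, rfl⟩ := Prod.mk.inj he
      exact hD.commute_self hkl ha hb
    · exact hD.commute hij hr he (Ne.symm hli') hjk' ha hb
  rw [commutatorElement_eq_one_iff_commute.mpr hcomm]
  exact K.one_mem

theorem core_apply_of_ne {n : ℕ} {D : LevelledRoots n} {R : Type*} [CommRing R] (l : D.core R)
    {a b : Fin n} (h : D.lvl a ≠ D.lvl b) : l.1 a b = 0 := by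
  have := congrFun (congrFun (D.levelDiag_coreIncl l) a) b
  rw [levelDiag_apply, if_neg h] at this
  exact this.symm

namespace Model

variable {n : ℕ} {D : LevelledRoots n} {R Γ : Type*} [CommRing R] {γ : Γ → R}
  {Q : Type*} [Group Q] (M : D.Model γ Q)

theorem ofCore_elem_mem_root (hn : 3 ≤ n)
    (hγ : ∀ r : R, r ∈ AddSubgroup.closure {x | ∃ (u : Rˣ) (g : Γ), x = (u : R) * γ g})
    {i j : Fin n} (h : D.rel i j) (hl : D.lvl i = D.lvl j) (r : R) :
    M.ofCore ⟨elem i j r, D.elem_mem_core h hl r⟩ ∈ M.root i j := by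
  obtain ⟨v, hv, hvr⟩ := M.exists_toMat_eq_elem hn hγ h r
  have hle : M.root i j ≤ M.ofCore.range := conjSpan_le fun t g => by
    rw [M.gen_eq h hl]
    exact mul_mem (mul_mem ⟨_, rfl⟩ ⟨_, rfl⟩) (inv_mem ⟨_, rfl⟩)
  obtain ⟨l, rfl⟩ := hle hv
  rw [M.toMat_ofCore] at hvr
  have : l = ⟨elem i j r, D.elem_mem_core h hl r⟩ := Subtype.ext hvr
  rwa [← this]

/-- The subgroup generated by the level-raising root subgroups preceding `t` in a suitable
order. -/
def raising (t : ℕ) : Subgroup Q :=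
  Subgroup.closure {v | ∃ i j, D.lvl i < D.lvl j ∧ j.val * n + i.val < t ∧ v ∈ M.root i j}

theorem root_le_raising {i j : Fin n} (h : D.lvl i < D.lvl j) {t : ℕ}
    (ht : j.val * n + i.val < t) : M.root i j ≤ M.raising t :=
  fun _ hv => Subgroup.subset_closure ⟨i, j, h, ht, hv⟩

theorem code_lt (i j : Fin n) : j.val * n + i.val < n * n := by
  have := Nat.mul_le_mul_right n (Nat.succ_le_of_lt j.2)
  rw [Nat.succ_mul] at this
  omega

theorem raising_normal (hn : 3 ≤ n)
    (hγ : ∀ r : R, r ∈ AddSubgroup.closure {x | ∃ (u : Rˣ) (g : Γ), x = (u : R) * γ g})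
    (hR : D.Rels M.torus M.gen) : (M.raising (n * n)).Normal := by
  have htorus : M.torus.range ≤ Subgroup.normalizer (M.raising (n * n)) := by
    rw [raising, Subgroup.le_normalizer_closure_iff]
    rintro _ ⟨t, rfl⟩ v ⟨k, l, hkl, -, hv⟩
    exact M.root_le_raising hkl (code_lt k l) (conjSpan_conj _ _ t hv)
  have hroot {i j : Fin n} (hij : D.rel i j) :
      M.root i j ≤ Subgroup.normalizer (M.raising (n * n)) := by
    have hle := D.le_of_rel hij
    conv_rhs => rw [raising]
    rw [Subgroup.le_normalizer_closure_iff]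
    rintro x hx v ⟨k, l, hkl, -, hv⟩
    refine hR.conj_mem hij hkl (M.root_le_raising hkl (code_lt k l)) ?_ ?_ hx hv
    · rintro rfl
      exact M.root_le_raising (hle.trans_lt hkl) (code_lt i l)
    · rintro rfl
      exact M.root_le_raising (hkl.trans_le hle) (code_lt k j)
  have hcore : ⊤ ≤ (Subgroup.normalizer (M.raising (n * n))).comap M.ofCore := by
    refine Subgroup.closure_closure_coe_preimage.ge.trans ((Subgroup.closure_le _).mpr ?_)
    rintro ⟨_, hx⟩ (⟨t, rfl⟩ | ⟨i, j, r, hij, hl, rfl⟩)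
    · exact htorus ⟨t, rfl⟩
    · exact hroot hij (M.ofCore_elem_mem_root hn hγ hij hl r)
  rw [← Subgroup.normalizer_eq_top_iff, eq_top_iff, ← M.closure_eq_top, Subgroup.closure_le]
  rintro _ (⟨l, rfl⟩ | ⟨i, j, g, hij, rfl⟩)
  · exact hcore (Subgroup.mem_top l)
  · exact hroot (D.rel_of_lt hij) (mem_conjSpan _ _ g)

theorem toMat_raising_apply {t : ℕ} {x : Q} (hx : x ∈ M.raising t) {a b : Fin n}
    (h : ¬ (D.lvl a < D.lvl b ∧ b.val * n + a.val < t)) :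
    M.toMat x a b = (1 : Matrix (Fin n) (Fin n) R) a b := by
  have hstep {k l : Fin n} (hkl : D.lvl k < D.lvl l) (ht : l.val * n + k.val < t) {v x : Q}
      (hv : v ∈ M.root k l)
      (ih : ∀ a b : Fin n, ¬ (D.lvl a < D.lvl b ∧ b.val * n + a.val < t) →
        M.toMat x a b = (1 : Matrix (Fin n) (Fin n) R) a b) {a b : Fin n}
      (h : ¬ (D.lvl a < D.lvl b ∧ b.val * n + a.val < t)) :
      M.toMat (v * x) a b = (1 : Matrix (Fin n) (Fin n) R) a b := by
    have hr := D.rel_of_lt hkl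
    obtain ⟨r, hr'⟩ := M.toMat_of_mem_root hr hv
    rw [map_mul, hr', elem_mul_apply (D.ne_of_rel hr), ih a b h, add_eq_left]
    split_ifs with hak
    · subst hak
      have hlb : l ≠ b := by
        rintro rfl
        exact h ⟨hkl, ht⟩
      have hlt : a.val < l.val := lt_of_not_ge fun h => hkl.not_ge (D.mono h)
      rw [ih l b fun h' => h ⟨hkl.trans h'.1, by omega⟩, Matrix.one_apply_ne hlb, mul_zero]
    · rfl
  induction hx using Subgroup.closure_induction_left generalizing a b with
  | one => rw [map_one]; rfl
  | mul_left v hv x _ ih =>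
    obtain ⟨k, l, hkl, ht, hv⟩ := hv
    exact hstep hkl ht hv (fun a b => ih) h
  | inv_mul_cancel v hv x _ ih =>
    obtain ⟨k, l, hkl, ht, hv⟩ := hv
    exact hstep hkl ht (inv_mem hv) (fun a b => ih) h

theorem eq_one_of_mem_raising (hR : D.Rels M.torus M.gen)
    (hinj : ∀ i j, D.lvl i < D.lvl j → ∀ v ∈ M.root i j, M.toMat v = 1 → v = 1) (t : ℕ) {x : Q}
    (hx : x ∈ M.raising t) (h1 : M.toMat x = 1) : x = 1 := by
  induction t generalizing x with
  | zero => simpa [raising] using hx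
  | succ t ih =>
    by_cases hp : ∃ p m : Fin n, D.lvl p < D.lvl m ∧ m.val * n + p.val = t
    · obtain ⟨p, m, hpm, rfl⟩ := hp
      have hcode {k l : Fin n} (h : l.val * n + k.val < m.val * n + p.val) :
          l < m ∨ l = m ∧ k < p := by
        rcases lt_trichotomy l m with h' | h' | h'
        · exact Or.inl h'
        · subst h'
          exact Or.inr ⟨rfl, Fin.lt_def.mpr (by omega)⟩
        · have := Nat.mul_le_mul_right n (Nat.succ_le_of_lt (Fin.lt_def.mp h'))
          rw [Nat.succ_mul] at this
          omega
      have hnorm : M.root p m ≤ Subgroup.normalizer (M.raising (m.val * n + p.val)) := by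
        conv_rhs => rw [raising]
        rw [Subgroup.le_normalizer_closure_iff]
        rintro v hv w ⟨k, l, hkl, hlt, hw⟩
        refine hR.conj_mem (D.rel_of_lt hpm) hkl (M.root_le_raising hkl hlt) ?_ ?_ hv hw
        · rintro rfl
          have h1 : m < l := lt_of_not_ge fun h => hkl.not_ge (D.mono h)
          rcases hcode hlt with h | h
          · exact absurd h h1.not_gt
          · exact absurd h.1 h1.ne'
        · rintro rfl
          have h1 : k < l := lt_of_not_ge fun h => hkl.not_ge (D.mono h)
          exact M.root_le_raising (hkl.trans hpm) (by simpa using h1)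
      have hle : M.raising (m.val * n + p.val + 1) ≤
          M.raising (m.val * n + p.val) ⊔ M.root p m := by
        rw [raising, Subgroup.closure_le]
        rintro v ⟨k, l, hkl, hlt, hv⟩
        rcases Nat.lt_succ_iff_lt_or_eq.mp hlt with h | h
        · exact Subgroup.mem_sup_left (M.root_le_raising hkl h hv)
        · have hl : l = m := by
            rcases lt_trichotomy l m with h' | h' | h'
            · have := Nat.mul_le_mul_right n (Nat.succ_le_of_lt (Fin.lt_def.mp h'))
              rw [Nat.succ_mul] at this
              omega
            · exact h'
            · have := Nat.mul_le_mul_right n (Nat.succ_le_of_lt (Fin.lt_def.mp h'))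
              rw [Nat.succ_mul] at this
              omega
          subst hl
          have hk : k = p := Fin.ext (by omega)
          subst hk
          exact Subgroup.mem_sup_right hv
      have hx' := hle hx
      rw [← SetLike.mem_coe, Subgroup.coe_mul_of_right_le_normalizer_left _ _ hnorm] at hx'
      obtain ⟨w, hw, v, hv, rfl⟩ := Set.mem_mul.mp hx'
      obtain ⟨r, hr⟩ := M.toMat_of_mem_root (D.rel_of_lt hpm) hv
      have hne := D.ne_of_rel (D.rel_of_lt hpm)
      have hwr : M.toMat w = elem p m (-r) := by
        rw [map_mul, hr] at h1
        rw [elem_neg, eq_inv_of_mul_eq_one_left h1]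
      have hwpm := M.toMat_raising_apply hw (a := p) (b := m) (by simp)
      rw [hwr, elem_apply_same hne, Matrix.one_apply_ne hne, neg_eq_zero] at hwpm
      subst hwpm
      rw [elem_zero] at hr
      rw [neg_zero, elem_zero] at hwr
      rw [ih hw hwr, hinj p m hpm v hv hr, mul_one]
    · refine ih ?_ h1
      refine (Subgroup.closure_le _).mpr ?_ hx
      rintro v ⟨k, l, hkl, hlt, hv⟩
      refine M.root_le_raising hkl (lt_of_le_of_ne (Nat.lt_succ_iff.mp hlt) ?_) hv
      exact fun h => hp ⟨k, l, hkl, h⟩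

theorem toMat_injective (hn : 3 ≤ n)
    (hγ : ∀ r : R, r ∈ AddSubgroup.closure {x | ∃ (u : Rˣ) (g : Γ), x = (u : R) * γ g})
    (hR : D.Rels M.torus M.gen)
    (hinj : ∀ i j, D.lvl i < D.lvl j → ∀ v ∈ M.root i j, M.toMat v = 1 → v = 1) :
    Function.Injective M.toMat := by
  have := M.raising_normal hn hγ hR
  refine (injective_iff_map_eq_one _).mpr fun q hq => ?_
  have htop : q ∈ M.raising (n * n) ⊔ M.ofCore.range := by
    have : (⊤ : Subgroup Q) ≤ M.raising (n * n) ⊔ M.ofCore.range := by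
      rw [← M.closure_eq_top, Subgroup.closure_le]
      rintro _ (⟨l, rfl⟩ | ⟨i, j, g, hij, rfl⟩)
      · exact Subgroup.mem_sup_right ⟨l, rfl⟩
      · exact Subgroup.mem_sup_left
          (M.root_le_raising hij (code_lt i j) (mem_conjSpan _ _ g))
    exact this (Subgroup.mem_top q)
  obtain ⟨x, hx, _, ⟨l, rfl⟩, rfl⟩ := Subgroup.mem_sup_of_normal_left.mp htop
  rw [map_mul, M.toMat_ofCore] at hq
  have hxl : M.toMat x = (l⁻¹ : D.core R).1 := eq_inv_of_mul_eq_one_left hq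
  have hx1 : M.toMat x = 1 := by
    ext a b
    by_cases hab : D.lvl a < D.lvl b
    · rw [hxl, core_apply_of_ne _ hab.ne]
      exact (Matrix.one_apply_ne fun h => hab.ne (by rw [h])).symm
    · exact M.toMat_raising_apply hx fun h => hab h.1
  have hl : l = 1 := by
    rw [hx1] at hxl
    exact inv_eq_one.mp (Subtype.ext hxl.symm)
  rw [M.eq_one_of_mem_raising hR hinj _ hx hx1, hl, map_one, mul_one]

end Model

end LevelledRoots

namespace LevelledRoots

namespace Model

variable {n : ℕ} {D : LevelledRoots n} {R Γ : Type*} [CommRing R] {γ : Γ → R}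
  {Q : Type*} [Group Q] (M : D.Model γ Q)

/-- The model on a quotient by a normal subgroup that is trivial in `SL_n(R)`. -/
def quotient (N : {N : Subgroup Q // N.Normal}) (hN : N.1 ≤ M.toMat.ker) :
    D.Model γ (Q ⧸ N.1) where
  ofCore := (QuotientGroup.mk' N.1).comp M.ofCore
  gen := M.quotGen N
  toMat := QuotientGroup.lift N.1 M.toMat hN
  toMat_ofCore := M.toMat_ofCore
  toMat_gen := M.toMat_gen
  gen_eq h hl g := congrArg (QuotientGroup.mk' N.1) (M.gen_eq h hl g)
  closure_eq_top := by
    rw [eq_top_iff, ← Subgroup.map_top_of_surjective _ (QuotientGroup.mk'_surjective N.1),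
      ← M.closure_eq_top, MonoidHom.map_closure]
    refine Subgroup.closure_mono ?_
    rintro _ ⟨_, ⟨l, rfl⟩ | ⟨i, j, g, hij, rfl⟩, rfl⟩
    · exact Or.inl ⟨l, rfl⟩
    · exact Or.inr ⟨i, j, g, hij, rfl⟩

theorem ker_isFinitelyNormallyGenerated [Group.FG Rˣ] [Finite Γ] (hn : 3 ≤ n)
    (hγ : ∀ r : R, r ∈ AddSubgroup.closure {x | ∃ (u : Rˣ) (g : Γ), x = (u : R) * γ g})
    (h1 : ∃ g, γ g = 1) :
    M.toMat.ker.IsFinitelyNormallyGenerated := by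
  have hroot : ∀ᶠ N in relFilter M.toMat.ker, ∀ i j, D.lvl i < D.lvl j →
      M.root i j ⊓ M.toMat.ker ≤ N.1 := by
    simp only [Filter.eventually_all]
    exact fun i j hij => M.eventually_root_inf_ker_le hn hγ h1 hij
  obtain ⟨S, hS, hSK, h⟩ :=
    eventually_relFilter_iff.mp ((M.eventually_rels hn hγ h1).and hroot)
  have hle := Subgroup.normalClosure_le_normal hSK
  refine ⟨S, hS, le_antisymm hle fun q hq => ?_⟩
  set N : {N : Subgroup Q // N.Normal} := ⟨Subgroup.normalClosure S, inferInstance⟩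
  obtain ⟨hR, hroot⟩ := h N Subgroup.subset_normalClosure
  have hinj := (M.quotient N hle).toMat_injective hn hγ hR fun i j hij v hv hv1 => by
    obtain ⟨a, ha, rfl⟩ := (M.root_map_quot N i j).ge hv
    exact (QuotientGroup.eq_one_iff a).mpr (hroot i j hij ⟨ha, hv1⟩)
  exact (QuotientGroup.eq_one_iff q).mp (hinj (hq.trans (map_one _).symm))

theorem range_toMat (hn : 3 ≤ n)
    (hγ : ∀ r : R, r ∈ AddSubgroup.closure {x | ∃ (u : Rˣ) (g : Γ), x = (u : R) * γ g}) :
    M.toMat.range = D.par R := by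
  refine le_antisymm ?_ ?_
  · rw [MonoidHom.range_eq_map, ← M.closure_eq_top, MonoidHom.map_closure, Subgroup.closure_le]
    rintro _ ⟨_, ⟨l, rfl⟩ | ⟨i, j, g, hij, rfl⟩, rfl⟩
    · rw [M.toMat_ofCore]
      exact D.core_le_par l.2
    · rw [M.toMat_gen (D.rel_of_lt hij)]
      exact D.elem_mem_par (D.rel_of_lt hij) _
  · rw [par, Subgroup.closure_le]
    rintro _ (⟨t, rfl⟩ | ⟨i, j, r, h, rfl⟩)
    · exact ⟨_, M.toMat_torus t⟩
    · obtain ⟨v, -, hv⟩ := M.exists_toMat_eq_elem hn hγ h r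
      exact ⟨v, hv⟩

end Model

/-- The generator indices of the universal model. -/
abbrev RaisingGen {n : ℕ} (D : LevelledRoots n) (Γ : Type*) : Type _ :=
  {p : Fin n × Fin n // D.lvl p.1 < D.lvl p.2} × Γ

open Classical in
/-- The free product of the core with the free group on the level-raising generators. -/
noncomputable def universalModel {n : ℕ} (D : LevelledRoots n) {R Γ : Type*} [CommRing R]
    (γ : Γ → R) : D.Model γ (Monoid.Coprod (D.core R) (FreeGroup (D.RaisingGen Γ))) where
  ofCore := Monoid.Coprod.inl
  gen i j g :=
    if hij : D.lvl i < D.lvl j then Monoid.Coprod.inr (FreeGroup.of (⟨(i, j), hij⟩, g))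
    else if h : D.rel i j ∧ D.lvl i = D.lvl j then
      Monoid.Coprod.inl ⟨elem i j (γ g), D.elem_mem_core h.1 h.2 _⟩
    else 1
  toMat := Monoid.Coprod.lift (D.core R).subtype
    (FreeGroup.lift fun x => elem x.1.1.1 x.1.1.2 (γ x.2))
  toMat_ofCore l := Monoid.Coprod.lift_apply_inl _ _ l
  toMat_gen {i j} h g := by
    by_cases hij : D.lvl i < D.lvl j
    · rw [dif_pos hij, Monoid.Coprod.lift_apply_inr, FreeGroup.lift_apply_of]
    · rw [dif_neg hij, dif_pos ⟨h, (D.le_of_rel h).eq_of_not_lt hij⟩,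
        Monoid.Coprod.lift_apply_inl]
      rfl
  gen_eq h hl g := by rw [dif_neg hl.not_lt, dif_pos ⟨h, hl⟩]
  closure_eq_top := by
    rw [eq_top_iff, ← Monoid.Coprod.range_inl_sup_range_inr, sup_le_iff]
    constructor
    · exact fun _ hx => Subgroup.subset_closure (Or.inl hx)
    · rw [MonoidHom.range_eq_map, ← FreeGroup.closure_range_of, MonoidHom.map_closure]
      refine Subgroup.closure_mono ?_
      rintro _ ⟨_, ⟨⟨⟨⟨i, j⟩, hij⟩, g⟩, rfl⟩, rfl⟩
      exact Or.inr ⟨i, j, g, hij, by rw [dif_pos hij]⟩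

theorem par_isFinitelyPresented_of_core {n : ℕ} (D : LevelledRoots n) {R Γ : Type*} [CommRing R]
    {γ : Γ → R} [Group.FG Rˣ] [Finite Γ] (hn : 3 ≤ n)
    (hγ : ∀ r : R, r ∈ AddSubgroup.closure {x | ∃ (u : Rˣ) (g : Γ), x = (u : R) * γ g})
    (h1 : ∃ g, γ g = 1) [Group.IsFinitelyPresented (D.core R)] :
    Group.IsFinitelyPresented (D.par R) := by
  rw [← (D.universalModel γ).range_toMat hn hγ]
  refine Group.IsFinitelyPresented.of_surjective _
    (D.universalModel γ).toMat.rangeRestrict_surjective ?_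
  rw [MonoidHom.ker_rangeRestrict]
  exact (D.universalModel γ).ker_isFinitelyNormallyGenerated hn hγ h1

end LevelledRoots

theorem mem_nonAdjSet_of_notMem {n : ℕ} {I : Set ℕ} {k : ℕ} (h1 : 1 ≤ k) (h2 : k < n)
    (hI : k ∉ I) (hA : k ∉ adjSet n I) : k ∈ nonAdjSet n I :=
  ⟨⟨h1, by omega⟩, fun h => h.elim hI hA⟩

theorem notMem_adjSet_of_mem_nonAdjSet {n : ℕ} {I : Set ℕ} {k : ℕ} (h : k ∈ nonAdjSet n I) :
    k ∉ adjSet n I :=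
  fun h' => h.2 (Or.inr h')

theorem notMem_adjSet_of_mem {n : ℕ} {I : Set ℕ} {k : ℕ} (h : k ∈ I) : k ∉ adjSet n I :=
  fun h' => h'.2.1 h

theorem iConn_or_iConn_nonAdjSet {n : ℕ} {I : Set ℕ} {i j : Fin n}
    (h : ∀ k : ℕ, i.val + 1 ≤ k → k ≤ j.val → k ∉ adjSet n I) :
    IConn I i j ∨ IConn (nonAdjSet n I) i j := by
  by_cases hi : i.val + 1 ∈ I
  · refine Or.inl fun k hk => ?_
    induction k, hk using Nat.le_induction with
    | base => exact fun _ => hi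
    | succ k hk ih =>
      intro hkj
      by_contra hkI
      exact h (k + 1) (by omega) hkj ⟨⟨by omega, by omega⟩, hkI, Or.inl (ih (by omega))⟩
  · refine Or.inr fun k hk hkj => ?_
    suffices k ∉ I from mem_nonAdjSet_of_notMem (by omega) (by omega) this (h k hk hkj)
    induction k, hk using Nat.le_induction with
    | base => exact hi
    | succ k hk ih =>
      intro hkI
      exact h k hk (by omega) ⟨⟨by omega, by omega⟩, ih (by omega), Or.inr hkI⟩

open Classical in
/-- The number of elements of `Adj(I)` up to a given index. -/
noncomputable def adjCount {n : ℕ} (I : Set ℕ) (i : Fin n) : ℕ :=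
  ((Finset.range (i.val + 1)).filter (· ∈ adjSet n I)).card

theorem adjCount_mono {n : ℕ} (I : Set ℕ) : Monotone (adjCount (n := n) I) := by
  classical
  exact fun i j h => Finset.card_le_card (Finset.filter_subset_filter _
    (Finset.range_mono (Nat.succ_le_succ (Fin.le_def.mp h))))

theorem adjCount_eq_iff {n : ℕ} {I : Set ℕ} {i j : Fin n} (hij : i ≤ j) :
    adjCount I i = adjCount I j ↔ ∀ k : ℕ, i.val + 1 ≤ k → k ≤ j.val → k ∉ adjSet n I := by
  classical
  have hle : i.val + 1 ≤ j.val + 1 := Nat.succ_le_succ (Fin.le_def.mp hij)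
  have hsub := Finset.filter_subset_filter (· ∈ adjSet n I) (Finset.range_mono hle)
  constructor
  · intro h k hk hkj hkA
    have := Finset.eq_of_subset_of_card_le hsub h.ge
    have hmem : k ∈ (Finset.range (j.val + 1)).filter (· ∈ adjSet n I) := by
      simp [hkA]
      omega
    rw [← this, Finset.mem_filter, Finset.mem_range] at hmem
    omega
  · intro h
    refine congrArg Finset.card (hsub.antisymm fun k hk => ?_)
    rw [Finset.mem_filter, Finset.mem_range] at hk ⊢
    refine ⟨?_, hk.2⟩
    by_contra hki
    exact h k (by omega) (by omega) hk.2

theorem IConn.adjCount_eq {n : ℕ} {I : Set ℕ} {i j : Fin n} (hij : i ≤ j) (h : IConn I i j) :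
    adjCount I i = adjCount I j :=
  (adjCount_eq_iff hij).mpr fun k hk hkj => notMem_adjSet_of_mem (h k hk hkj)

/-- The roots of the standard parabolic subgroup of `I`, levelled by `Adj(I)`. -/
noncomputable def stdRoots {n : ℕ} {I : Set ℕ} (hI : I ⊆ Set.Icc 1 (n - 1)) :
    LevelledRoots n where
  lvl := adjCount I
  rel i j := i < j ∨ j < i ∧ IConn I j i
  mono := adjCount_mono I
  ne_of_rel h := h.elim ne_of_lt fun h => h.1.ne'
  le_of_rel h := h.elim (fun h => adjCount_mono I h.le) fun h => (h.2.adjCount_eq h.1.le).ge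
  rel_of_lt h := Or.inl (lt_of_not_ge fun h' => h.not_ge (adjCount_mono I h'))
  trans {i j l} hij hjl hil := by
    rcases hil.lt_or_gt with h | h
    · exact Or.inl h
    refine Or.inr ⟨h, fun k hk hki => ?_⟩
    rw [Fin.lt_def] at h
    by_cases hkj : k ≤ j.val
    · rcases hjl with h' | h'
      · rw [Fin.lt_def] at h'
        omega
      · exact h'.2 k hk hkj
    · rcases hij with h' | h'
      · rw [Fin.lt_def] at h'
        omega
      · exact h'.2 k (by omega) hki
  exists_mid {i j} hl := by
    have hij : i < j := lt_of_not_ge fun h' => hl.not_ge (adjCount_mono I h')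
    have hlt := Fin.lt_def.mp hij
    by_cases hs : i.val + 1 < j.val
    · exact ⟨⟨i.val + 1, by omega⟩, Or.inl (Fin.lt_def.mpr (Nat.lt_succ_self _)),
        Or.inl (Fin.lt_def.mpr hs)⟩
    have hj : j.val ∈ adjSet n I := by
      by_contra hA
      refine hl.ne ((adjCount_eq_iff hij.le).mpr fun k hk hkj => ?_)
      rwa [show k = j.val by omega]
    rcases hj.2.2 with h | h
    · have h1 := (hI h).1
      have hk : i.val - 1 < i.val := by omega
      refine ⟨⟨i.val - 1, by omega⟩, Or.inr ⟨Fin.lt_def.mpr hk, fun k hk hki => ?_⟩,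
        Or.inl (Fin.lt_def.mpr (hk.trans hlt))⟩
      have hk : i.val - 1 + 1 ≤ k := hk
      rwa [show k = j.val - 1 by omega]
    · have h1 := (hI h).2
      refine ⟨⟨j.val + 1, by omega⟩, Or.inl (Fin.lt_def.mpr (hlt.trans (Nat.lt_succ_self _))),
        Or.inr ⟨Fin.lt_def.mpr (Nat.lt_succ_self _), fun k hk hki => ?_⟩⟩
      have hki : k ≤ j.val + 1 := hki
      rwa [show k = j.val + 1 by omega]

theorem elemMat_eq_elem {n : ℕ} {R : Type*} [CommRing R] {i j : Fin n} (h : i ≠ j) (r : R) :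
    elemMat i j h r = elem i j r :=
  Subtype.ext (coe_elem h r).symm

theorem parabolic_eq_par {n : ℕ} (R : Type*) [CommRing R] {I : Set ℕ}
    (hI : I ⊆ Set.Icc 1 (n - 1)) : parabolic n R I = (stdRoots hI).par R := by
  refine congrArg Subgroup.closure ?_
  ext g
  rw [Set.union_assoc, Set.mem_union, Set.mem_union, mem_diagMats_iff]
  refine or_congr_right ⟨?_, ?_⟩
  · rintro (⟨i, j, h, r, rfl⟩ | ⟨i, j, h, r, hc, rfl⟩)
    · exact ⟨i, j, r, Or.inl h, elemMat_eq_elem _ r⟩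
    · exact ⟨j, i, r, Or.inr ⟨h, hc⟩, elemMat_eq_elem _ r⟩
  · rintro ⟨i, j, r, h | ⟨h, hc⟩, rfl⟩
    · exact Or.inl ⟨i, j, h, r, (elemMat_eq_elem _ r).symm⟩
    · exact Or.inr ⟨j, i, h, r, hc, (elemMat_eq_elem _ r).symm⟩

theorem extLevi_eq_core {n : ℕ} (R : Type*) [CommRing R] {I : Set ℕ}
    (hI : I ⊆ Set.Icc 1 (n - 1)) : extLevi n R I = (stdRoots hI).core R := by
  refine congrArg Subgroup.closure ?_
  ext g
  rw [Set.union_assoc, Set.union_assoc, Set.mem_union, Set.mem_union, mem_diagMats_iff]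
  refine or_congr_right ⟨?_, ?_⟩
  · rintro (⟨i, j, h, r, hc, rfl⟩ | ⟨i, j, h, r, hc, rfl⟩ | ⟨i, j, h, r, hc, rfl⟩)
    · exact ⟨i, j, r, Or.inl h, hc.adjCount_eq h.le, elemMat_eq_elem _ r⟩
    · exact ⟨j, i, r, Or.inr ⟨h, hc⟩, (hc.adjCount_eq h.le).symm, elemMat_eq_elem _ r⟩
    · exact ⟨i, j, r, Or.inl h, (adjCount_eq_iff h.le).mpr
        fun k hk hkj => notMem_adjSet_of_mem_nonAdjSet (hc k hk hkj), elemMat_eq_elem _ r⟩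
  · rintro ⟨i, j, r, h | ⟨h, hc⟩, hl, rfl⟩
    · rcases iConn_or_iConn_nonAdjSet ((adjCount_eq_iff h.le).mp hl) with hc | hc
      · exact Or.inl ⟨i, j, h, r, hc, (elemMat_eq_elem _ r).symm⟩
      · exact Or.inr (Or.inr ⟨i, j, h, r, hc, (elemMat_eq_elem _ r).symm⟩)
    · exact Or.inr (Or.inl ⟨j, i, h, r, hc, (elemMat_eq_elem _ r).symm⟩)

theorem LevelledRoots.par_eq_core_or_three_le {n : ℕ} (D : LevelledRoots n) (R : Type*)
    [CommRing R] : D.par R = D.core R ∨ 3 ≤ n := by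
  by_cases h : ∃ i j, D.lvl i < D.lvl j
  · obtain ⟨i, j, h⟩ := h
    obtain ⟨k, hik, hkj⟩ := D.exists_mid h
    have h1 := Fin.val_ne_of_ne (D.ne_of_rel hik)
    have h2 := Fin.val_ne_of_ne (D.ne_of_rel hkj)
    have h3 := Fin.val_ne_of_ne (D.ne_of_rel (D.rel_of_lt h))
    omega
  · push Not at h
    refine Or.inl (le_antisymm (Subgroup.closure_mono (Set.union_subset_union_right _ ?_))
      D.core_le_par)
    rintro g ⟨i, j, r, hij, hg⟩
    exact ⟨i, j, r, hij, (h j i).antisymm (h i j), hg⟩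

/-- Main theorem (type A_{n-1}): if all standard parabolic subgroups of SL_n(R) are
finitely generated, then for every nonempty I ⊆ {1,…,n−1}, P_I(R) is finitely
presented iff its extended Levi factor LE_I(R) is finitely presented. -/
theorem parabolic_finitelyPresented_iff_extLevi
    {R : Type*} [CommRing R] {n : ℕ} (hn : 2 ≤ n)
    (hfg : ∀ J : Set ℕ, J ⊆ Set.Icc 1 (n - 1) → Group.FG ↥(parabolic n R J))
    (I : Set ℕ) (hI : I ⊆ Set.Icc 1 (n - 1)) (hne : I.Nonempty) :
    IsFinitelyPresented ↥(parabolic n R I) ↔ IsFinitelyPresented ↥(extLevi n R I) := by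
  rw [isFinitelyPresented_iff_group, isFinitelyPresented_iff_group, parabolic_eq_par R hI,
    extLevi_eq_core R hI]
  refine ⟨fun h => (stdRoots hI).core_isFinitelyPresented_of_par, fun h => ?_⟩
  rcases (stdRoots hI).par_eq_core_or_three_le R with heq | hn3
  · rwa [heq]
  have hB := hfg ∅ (Set.empty_subset _)
  have := units_fg_of_borel_fg hn hB
  obtain ⟨Γ, hΓ⟩ := exists_finset_units_span_of_borel_fg hn hB
  classical
  refine (stdRoots hI).par_isFinitelyPresented_of_core
    (γ := (Subtype.val : ↥(insert 1 Γ) → R)) hn3 (fun r => ?_) ⟨⟨1, by simp⟩, rfl⟩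
  refine AddSubgroup.closure_mono ?_ (hΓ r)
  rintro _ ⟨u, g, rfl⟩
  exact ⟨u, ⟨g, by simp⟩, rfl⟩
end

section
/- Suppose that for every subset J ⊆ {1,…,n−1} the standard parabolic subgroup P_J(R) ≤ SL_n(R) is finitely generated. Then the standard Borel subgroup P_∅(R) — the subgroup of SL_n(R) generated by D_n(R) and all e_{ij}(r) with i < j and r ∈ R — is finitely presented if and only if for every k ∈ {1,…,n−1} the k-th extended Levi factor LE_k(R) is finitely presented. -/
/-- The k-th extended Levi factor of the Borel subgroup: generated by the diagonal
matrices and the elementary matrices `e_{k,k+1}(r)` (1-based indexing of simple roots). -/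
def borelExtLevi (n : ℕ) (R : Type*) [CommRing R] (k : ℕ) :
    Subgroup (Matrix.SpecialLinearGroup (Fin n) R) :=
  Subgroup.closure (diagMats n R ∪ upperElems n R {k})

namespace BorelPresentation

open Group Monoid

section FinitelyPresented

theorem isFinitelyPresented_iff (G : Type*) [Group G] :
    _root_.IsFinitelyPresented G ↔ Group.IsFinitelyPresented G := by
  constructor
  · rintro ⟨m, S, ⟨e⟩⟩
    have := Group.IsFinitelyPresented.quotient (Subgroup.normalClosure (S : Set (FreeGroup (Fin m))))
      ⟨S, S.finite_toSet, rfl⟩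
    exact .equiv e
  · rintro ⟨n, φ, hφ, S, hS, hSφ⟩
    refine ⟨n, hS.toFinset, ⟨?_⟩⟩
    exact (QuotientGroup.quotientMulEquivOfEq (by simpa using hSφ)).trans
      (QuotientGroup.quotientKerEquivOfSurjective φ hφ)

theorem ker_eq_of_comp_eq_mk' {E G : Type*} [Group E] [Group G] {f : E →* G} {N : Subgroup E}
    [N.Normal] (hN : N ≤ f.ker) (g : G →* E ⧸ N) (hg : g.comp f = QuotientGroup.mk' N) :
    f.ker = N := by
  refine le_antisymm (fun x hx => ?_) hN
  rw [← QuotientGroup.eq_one_iff, ← QuotientGroup.mk'_apply, ← hg, MonoidHom.comp_apply,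
    MonoidHom.mem_ker.1 hx, map_one]

/-- A retract of a finitely presented group is finitely presented. -/
theorem finitelyPresented_of_retract {G H : Type*} [Group G] [Group H]
    [hG : Group.IsFinitelyPresented G] (r : G →* H) (s : H →* G)
    (hrs : r.comp s = MonoidHom.id H) : Group.IsFinitelyPresented H := by
  have hrs' : ∀ h, r (s h) = h := fun h => DFunLike.congr_fun hrs h
  obtain ⟨n, φ, hφ, -⟩ := hG.out
  let T : Set G := Set.range fun i : Fin n => (φ (.of i))⁻¹ * s (r (φ (.of i)))
  refine Group.IsFinitelyPresented.of_surjective r (fun h => ⟨s h, hrs' h⟩)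
    ⟨T, Set.finite_range _, ?_⟩
  have hT : Subgroup.normalClosure T ≤ r.ker := by
    refine Subgroup.normalClosure_le_normal ?_
    rintro _ ⟨i, rfl⟩
    simp [hrs']
  refine (ker_eq_of_comp_eq_mk' hT ((QuotientGroup.mk' _).comp s) ?_).symm
  rw [← MonoidHom.cancel_right hφ]
  ext i
  refine (QuotientGroup.eq.2 (Subgroup.subset_normalClosure ?_)).symm
  exact ⟨i, rfl⟩

/-- A finite free product of finitely presented groups is finitely presented. -/
theorem finitelyPresented_coprodI {ι : Type*} [Finite ι] (A : ι → Type*) [∀ i, Group (A i)]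
    (hA : ∀ i, Group.IsFinitelyPresented (A i)) : Group.IsFinitelyPresented (CoprodI A) := by
  choose n φ hφ S hS hSφ using fun i => (hA i).out
  let incl (i : ι) : FreeGroup (Fin (n i)) →* FreeGroup (Σ i, Fin (n i)) :=
    FreeGroup.map fun k => ⟨i, k⟩
  let f : FreeGroup (Σ i, Fin (n i)) →* CoprodI A :=
    FreeGroup.lift fun k => CoprodI.of (φ k.1 (.of k.2))
  have hf (i : ι) : f.comp (incl i) = CoprodI.of.comp (φ i) := by
    ext k
    simp [f, incl]
  have hf' (i : ι) (w) : f (incl i w) = CoprodI.of (φ i w) := DFunLike.congr_fun (hf i) w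
  let T : Set (FreeGroup (Σ i, Fin (n i))) := ⋃ i, incl i '' S i
  have hT : Subgroup.normalClosure T ≤ f.ker := by
    refine Subgroup.normalClosure_le_normal (Set.iUnion_subset fun i => ?_)
    rintro _ ⟨w, hw, rfl⟩
    have : w ∈ (φ i).ker := hSφ i ▸ Subgroup.subset_normalClosure hw
    simp [hf', MonoidHom.mem_ker.1 this]
  let q (i : ι) : A i →* _ ⧸ Subgroup.normalClosure T :=
    MonoidHom.liftOfSurjective (φ i) (hφ i) ⟨(QuotientGroup.mk' _).comp (incl i), by
      rw [← hSφ i]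
      refine Subgroup.normalClosure_le_normal fun w hw => ?_
      refine (QuotientGroup.eq_one_iff _).2 (Subgroup.subset_normalClosure ?_)
      exact Set.mem_iUnion.2 ⟨i, w, hw, rfl⟩⟩
  have hq (i : ι) (w) : q i (φ i w) = QuotientGroup.mk' _ (incl i w) :=
    MonoidHom.liftOfRightInverse_comp_apply _ _ _ _ w
  refine Group.IsFinitelyPresented.of_surjective f ?_
    ⟨T, Set.finite_iUnion fun i => (hS i).image _, ?_⟩
  · rw [← MonoidHom.range_eq_top, eq_top_iff]
    intro x _
    induction x using CoprodI.induction_on with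
    | one => exact one_mem _
    | of i a =>
      obtain ⟨w, rfl⟩ := hφ i a
      exact ⟨incl i w, hf' i w⟩
    | mul x y hx hy => exact mul_mem (hx trivial) (hy trivial)
  · refine (ker_eq_of_comp_eq_mk' hT (CoprodI.lift q) ?_).symm
    ext ⟨i, k⟩
    simp [f, hq, incl]

end FinitelyPresented

section Torus

variable {n : ℕ} {R : Type*} [CommRing R]

/-- Tuples of `n` units with product one, parametrising the diagonal matrices in `SL_n(R)`. -/
def torus (n : ℕ) (R : Type*) [CommRing R] : Subgroup (Fin n → Rˣ) where
  carrier := {t | ∏ i, t i = 1}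
  one_mem' := by simp
  mul_mem' {a b} ha hb := by
    simp only [Set.mem_ofPred_eq] at *
    simp [Finset.prod_mul_distrib, ha, hb]
  inv_mem' {a} ha := by
    simp only [Set.mem_ofPred_eq] at *
    simp [ha]

/-- The character `t ↦ t_i / t_j` of the torus. -/
def rootChar (i j : Fin n) : torus n R →* Rˣ where
  toFun t := t.1 i / t.1 j
  map_one' := by simp
  map_mul' a b := by simp [mul_div_mul_comm]

theorem rootChar_apply (i j : Fin n) (t : torus n R) : rootChar i j t = t.1 i / t.1 j := rfl

theorem rootChar_mul_rootChar (i j l : Fin n) (t : torus n R) :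
    rootChar i j t * rootChar j l t = rootChar i l t := by
  simp [rootChar_apply]

/-- The torus contains an element on which a prescribed root takes an arbitrary `n`-th power as
value while a second root, not supported on the same two indices, is trivial. -/
theorem exists_torus_rootChar {i j k l : Fin n} (hij : i ≠ j)
    (h : (i ≠ k ∧ i ≠ l) ∨ (j ≠ k ∧ j ≠ l)) (w : Rˣ) :
    ∃ t : torus n R, rootChar i j t = w ^ n ∧ rootChar k l t = 1 := by
  have key (a : Fin n) (w : Rˣ) :
      (fun b => (if b = a then w ^ n else 1) * w⁻¹ : Fin n → Rˣ) ∈ torus n R := by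
    change ∏ b, _ = 1
    rw [Finset.prod_mul_distrib]
    simp
  rcases h with h | h
  · refine ⟨⟨_, key i w⟩, ?_, ?_⟩
    · simp [rootChar_apply, hij.symm]
    · simp [rootChar_apply, h.1.symm, h.2.symm]
  · refine ⟨⟨_, key j w⁻¹⟩, ?_, ?_⟩
    · simp [rootChar_apply, hij]
    · simp [rootChar_apply, h.1.symm, h.2.symm]

/-- The action of units on the additive group by multiplication. -/
def unitsMulAut (R : Type*) [CommRing R] : Rˣ →* MulAut (Multiplicative R) :=
  (MulAutMultiplicative R).symm.toMonoidHom.comp (DistribMulAction.toAddAut Rˣ R)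

theorem unitsMulAut_ofAdd (u : Rˣ) (r : R) :
    unitsMulAut R u (.ofAdd r) = .ofAdd ((u : R) * r) := rfl

/-- The root subgroup extended by the torus: the abstract model of `LE_k(R)`. -/
abbrev RootGroup (R : Type*) [CommRing R] (i j : Fin n) :=
  Multiplicative R ⋊[(unitsMulAut R).comp (rootChar i j)] torus n R

theorem RootGroup.inr_mul_inl (i j : Fin n) (t : torus n R) (r : R) :
    (SemidirectProduct.inr t * SemidirectProduct.inl (.ofAdd r) : RootGroup R i j) =
      SemidirectProduct.inl (.ofAdd ((rootChar i j t : R) * r)) * SemidirectProduct.inr t := by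
  rw [← unitsMulAut_ofAdd, ← MonoidHom.comp_apply, SemidirectProduct.inl_aut]
  simp

/-- The root groups of any two roots are isomorphic, through a permutation of the coordinates. -/
theorem RootGroup.nonempty_mulEquiv {i j k l : Fin n} (hij : i ≠ j) (hkl : k ≠ l) :
    Nonempty (RootGroup R i j ≃* RootGroup R k l) := by
  obtain ⟨σ, hσi, hσj⟩ : ∃ σ : Equiv.Perm (Fin n), σ k = i ∧ σ l = j := by
    refine ⟨(Equiv.swap k i).trans (Equiv.swap (Equiv.swap k i l) j), ?_, by simp⟩
    have h : Equiv.swap k i l ≠ i := by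
      rw [Ne, Equiv.swap_apply_eq_iff, Equiv.swap_apply_right]
      exact hkl.symm
    simp [Equiv.swap_apply_of_ne_of_ne h.symm hij]
  let e : torus n R ≃* torus n R :=
    { toFun := fun t => ⟨fun b => t.1 (σ b), by
        change ∏ b, _ = 1
        rw [Equiv.prod_comp σ t.1]; exact t.2⟩
      invFun := fun t => ⟨fun b => t.1 (σ.symm b), by
        change ∏ b, _ = 1
        rw [Equiv.prod_comp σ.symm t.1]; exact t.2⟩
      left_inv := fun t => by ext; simp
      right_inv := fun t => by ext; simp
      map_mul' := fun _ _ => rfl }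
  refine ⟨SemidirectProduct.congr (MulEquiv.refl _) e fun t => ?_⟩
  have : rootChar k l (e t) = rootChar i j t := by
    simp [rootChar_apply, e, hσi, hσj]
  ext r
  simp [this]

end Torus

section Spanning

variable {n : ℕ} {R : Type*} [CommRing R]

/-- `M` generates `R` as a module over the subring generated by `n`-th powers of units. -/
def SpansOverPowers (n : ℕ) (M : Set R) : Prop :=
  ∀ A : AddSubgroup R, M ⊆ A → (∀ (w : Rˣ) (r : R), r ∈ A → (w : R) ^ n * r ∈ A) → A = ⊤

theorem torus_fg_of_rootGroup_fg (i j : Fin n) [Group.FG (RootGroup R i j)] :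
    Group.FG (torus n R) :=
  Group.fg_of_surjective
    (f := SemidirectProduct.rightHom (φ := (unitsMulAut R).comp (rootChar i j)))
    SemidirectProduct.rightHom_surjective

theorem finite_quotient_range_powMonoidHom {T : Type*} [CommGroup T] [Group.FG T] {m : ℕ}
    (hm : 0 < m) : Finite (T ⧸ (powMonoidHom m : T →* T).range) := by
  refine CommGroup.finite_of_fg_isMulTorsion _ fun q => ?_
  induction q using QuotientGroup.induction_on with
  | H t =>
    refine isOfFinOrder_iff_pow_eq_one.2 ⟨m, hm, ?_⟩
    rw [← QuotientGroup.mk_pow, QuotientGroup.eq_one_iff]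
    exact ⟨t, rfl⟩

theorem exists_finite_spansOverPowers (hn : 0 < n) (i j : Fin n)
    [hfg : Group.FG (RootGroup R i j)] : ∃ M : Set R, M.Finite ∧ SpansOverPowers n M := by
  have := torus_fg_of_rootGroup_fg (R := R) i j
  have := finite_quotient_range_powMonoidHom (T := torus n R) hn
  obtain ⟨S, hS⟩ := hfg.out
  let m (k : (torus n R ⧸ (powMonoidHom n : torus n R →* torus n R).range) × S) : R :=
    (rootChar i j k.1.out : R) * k.2.1.left.toAdd
  refine ⟨Set.range m, Set.finite_range _, fun A hA hpow => ?_⟩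
  let W : Subgroup (RootGroup R i j) :=
    { carrier := {g | ∀ t : torus n R, (rootChar i j t : R) * g.left.toAdd ∈ A}
      one_mem' := fun t => by simp
      mul_mem' := fun {g h} hg hh t => by
        have := hh (t * g.right)
        simp only [SemidirectProduct.mul_left, toAdd_mul, mul_add]
        refine add_mem (hg t) ?_
        rw [map_mul, Units.val_mul, mul_assoc] at this
        exact this
      inv_mem' := fun {g} hg t => by
        have := hg (t * g.right⁻¹)
        rw [map_mul, Units.val_mul, mul_assoc] at this
        rw [← neg_mem_iff] at this
        convert this using 1
        rw [← mul_neg, ← mul_neg]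
        rfl }
  have hW : W = ⊤ := by
    rw [eq_top_iff, ← hS, Subgroup.closure_le]
    intro s hs t
    obtain ⟨⟨_, ⟨u, rfl⟩⟩, hu⟩ := QuotientGroup.mk_out_eq_mul
      (powMonoidHom n : torus n R →* torus n R).range t
    have h1 := hpow (rootChar i j u⁻¹) _ (hA ⟨(QuotientGroup.mk t, ⟨s, hs⟩), rfl⟩)
    convert h1 using 1
    simp only [m]
    rw [hu, ← mul_assoc, ← Units.val_pow_eq_pow_val, ← map_pow, ← Units.val_mul, ← map_mul]
    congr 3
    simp [mul_comm t]
  rw [eq_top_iff]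
  intro r _
  have : SemidirectProduct.inl (.ofAdd r) ∈ W := hW ▸ Subgroup.mem_top _
  simpa using this 1

end Spanning

section BorelSystem

variable {n : ℕ} {R Q : Type*} [CommRing R] [Group Q]

/-- Homomorphisms from the root subgroups and the torus into a group `Q` satisfying the
defining relations of the group of upper triangular matrices in `SL_n(R)`. The index range of the
root homomorphisms is extended to all pairs by triviality. -/
structure IsBorelSystem (x : Fin n → Fin n → Multiplicative R →* Q) (δ : torus n R →* Q) :
    Prop where
  eq_one : ∀ i j, ¬ i < j → x i j = 1
  torus_conj : ∀ i j, i < j → ∀ t r,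
    SemiconjBy (δ t) (x i j (.ofAdd r)) (x i j (.ofAdd ((rootChar i j t : R) * r)))
  commute : ∀ i j k l, i < j → k < l → j ≠ k → l ≠ i → ∀ r s, Commute (x i j r) (x k l s)
  bracket : ∀ i j l, i < j → j < l → ∀ r s : R, x i j (.ofAdd r) * x j l (.ofAdd s) =
    x i l (.ofAdd (r * s)) * x j l (.ofAdd s) * x i j (.ofAdd r)
  closure_eq_top : Subgroup.closure
    ({q | ∃ i j, i < j ∧ ∃ r : R, q = x i j (.ofAdd r)} ∪ Set.range δ) = ⊤

theorem semiconjBy_list_map_prod {ι : Type*} {g : Q} {f f' : ι → Q} {L : List ι}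
    (h : ∀ j ∈ L, SemiconjBy g (f j) (f' j)) : SemiconjBy g (L.map f).prod (L.map f').prod := by
  induction L with
  | nil => simp
  | cons j L ih =>
    simp only [List.map_cons, List.prod_cons]
    exact (h j (by simp)).mul_right (ih fun k hk => h k (by simp [hk]))

theorem semiconjBy_map_of_mulSingle {P : Type*} [CommGroup P] (f : (Fin n → P) →* Q)
    (θ : (Fin n → P) →* (Fin n → P)) (g : Q)
    (h : ∀ i s, SemiconjBy g (f (Pi.mulSingle i s)) (f (θ (Pi.mulSingle i s)))) (v : Fin n → P) :
    SemiconjBy g (f v) (f (θ v)) := by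
  have : (MulAut.conj g).toMonoidHom.comp f = f.comp θ := MonoidHom.pi_ext fun i s => by
    simpa [mul_inv_eq_iff_eq_mul] using (h i s).eq
  have := DFunLike.congr_fun this v
  simpa [mul_inv_eq_iff_eq_mul, SemiconjBy] using this

/-- Upper triangular with ones on the diagonal. -/
def IsUnitriangular (M : Matrix (Fin n) (Fin n) R) : Prop :=
  (∀ i, M i i = 1) ∧ ∀ i j, j < i → M i j = 0

namespace IsBorelSystem

variable {x : Fin n → Fin n → Multiplicative R →* Q} {δ : torus n R →* Q}

theorem pairwise_commute (h : IsBorelSystem x δ) (j : Fin n) :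
    Pairwise fun i i' => ∀ r s, Commute (x i j r) (x i' j s) := by
  intro i i' _ r s
  by_cases hi : i < j
  · by_cases hi' : i' < j
    · exact h.commute _ _ _ _ hi hi' hi'.ne' hi.ne' r s
    · simp [h.eq_one _ _ hi']
  · simp [h.eq_one _ _ hi]

/-- The homomorphism from the `j`-th column subgroup. -/
noncomputable def col (h : IsBorelSystem x δ) (j : Fin n) : (Fin n → Multiplicative R) →* Q :=
  MonoidHom.noncommPiCoprod (fun i => x i j) (h.pairwise_commute j)

theorem col_mulSingle (h : IsBorelSystem x δ) (i j : Fin n) (r : Multiplicative R) :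
    h.col j (Pi.mulSingle i r) = x i j r := by
  simp [col]

/-- The element of `Q` attached to the `j`-th column of a matrix. -/
noncomputable def matCol (h : IsBorelSystem x δ) (M : Matrix (Fin n) (Fin n) R) (j : Fin n) : Q :=
  h.col j fun i => .ofAdd (M i j)

/-- The element of `Q` attached to a unitriangular matrix. -/
noncomputable def unipotent (h : IsBorelSystem x δ) (M : Matrix (Fin n) (Fin n) R) : Q :=
  ((List.finRange n).reverse.map (h.matCol M)).prod

theorem unipotent_one (h : IsBorelSystem x δ) : h.unipotent 1 = 1 := by
  refine List.prod_eq_one fun q hq => ?_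
  obtain ⟨j, -, rfl⟩ := List.mem_map.1 hq
  have : (fun i => .ofAdd ((1 : Matrix (Fin n) (Fin n) R) i j)) =
      Pi.mulSingle (M := fun _ => Multiplicative R) j (.ofAdd 1) := by
    ext i
    by_cases hi : i = j
    · subst hi; simp
    · simp [hi]
  rw [matCol, this, col_mulSingle, h.eq_one _ _ (lt_irrefl j), MonoidHom.one_apply]

theorem semiconjBy_torus_unipotent (h : IsBorelSystem x δ) (t : torus n R)
    (M : Matrix (Fin n) (Fin n) R) :
    SemiconjBy (δ t) (h.unipotent M)
      (h.unipotent (.of fun i j => (rootChar i j t : R) * M i j)) := by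
  refine semiconjBy_list_map_prod fun j _ => ?_
  let θ : (Fin n → Multiplicative R) →* (Fin n → Multiplicative R) :=
    MonoidHom.pi fun i => ((unitsMulAut R (rootChar i j t)).toMonoidHom.comp
      (Pi.evalMonoidHom _ i))
  refine semiconjBy_map_of_mulSingle (h.col j) θ (δ t) (fun i s => ?_) fun i => .ofAdd (M i j)
  have : θ (Pi.mulSingle i s) = Pi.mulSingle i (unitsMulAut R (rootChar i j t) s) := by
    ext k
    by_cases hk : k = i
    · subst hk; simp [θ]
    · simp [θ, hk]
  rw [this, col_mulSingle, col_mulSingle]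
  by_cases hij : i < j
  · exact h.torus_conj i j hij t s.toAdd
  · simp [h.eq_one _ _ hij]

theorem semiconjBy_matCol (h : IsBorelSystem x δ) {a b j : Fin n} (hab : a < b) (hbj : b < j)
    (r : R) (M : Matrix (Fin n) (Fin n) R) :
    SemiconjBy (x a b (.ofAdd r)) (h.matCol M j) (h.matCol (Matrix.transvection a b r * M) j) := by
  let θ : (Fin n → Multiplicative R) →* (Fin n → Multiplicative R) :=
    { toFun := fun v => Pi.mulSingle a (.ofAdd (r * (v b).toAdd)) * v
      map_one' := by simp
      map_mul' := fun v w => by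
        rw [Pi.mul_apply, toAdd_mul, mul_add, ofAdd_add, Pi.mulSingle_mul]
        exact mul_mul_mul_comm _ _ _ _ }
  have key := semiconjBy_map_of_mulSingle (h.col j) θ (x a b (.ofAdd r)) (fun i s => ?_)
    fun i => .ofAdd (M i j)
  · convert key using 1
    rw [matCol]
    congr 1
    ext i
    by_cases hi : i = a
    · subst hi
      simp [Matrix.transvection_mul_apply_same, add_comm]
    · simp [hi, Matrix.transvection_mul_apply_of_ne]
  · by_cases hi : i = b
    · subst hi
      simpa [SemiconjBy, θ, col_mulSingle] using h.bracket a i j hab hbj r s.toAdd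
    · have : θ (Pi.mulSingle i s) = Pi.mulSingle i s := by
        simp [θ, Ne.symm hi]
      rw [this, col_mulSingle]
      by_cases hij : i < j
      · exact h.commute _ _ _ _ hab hij (Ne.symm hi) (hab.trans hbj).ne' _ _
      · simp [h.eq_one _ _ hij]

theorem mul_matCol_self (h : IsBorelSystem x δ) {a b : Fin n} (r : R)
    {M : Matrix (Fin n) (Fin n) R} (hM : M b b = 1) :
    x a b (.ofAdd r) * h.matCol M b = h.matCol (Matrix.transvection a b r * M) b := by
  rw [← h.col_mulSingle, matCol, matCol, ← map_mul]
  congr 1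
  ext i
  by_cases hi : i = a
  · subst hi
    simp [Matrix.transvection_mul_apply_same, hM, add_comm]
  · simp [hi, Matrix.transvection_mul_apply_of_ne]

theorem matCol_of_eq_zero (h : IsBorelSystem x δ) {a b j : Fin n} (r : R)
    {M : Matrix (Fin n) (Fin n) R} (hM : M b j = 0) :
    h.matCol (Matrix.transvection a b r * M) j = h.matCol M j := by
  rw [matCol, matCol]
  congr 1
  ext i
  by_cases hi : i = a
  · subst hi
    simp [Matrix.transvection_mul_apply_same, hM]
  · simp [hi, Matrix.transvection_mul_apply_of_ne]

theorem mul_unipotent (h : IsBorelSystem x δ) {a b : Fin n} (hab : a < b) (r : R)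
    {M : Matrix (Fin n) (Fin n) R} (hM : IsUnitriangular M) :
    x a b (.ofAdd r) * h.unipotent M = h.unipotent (Matrix.transvection a b r * M) := by
  suffices H : ∀ L : List (Fin n), L.Pairwise (· > ·) → b ∈ L →
      x a b (.ofAdd r) * (L.map (h.matCol M)).prod =
        (L.map (h.matCol (Matrix.transvection a b r * M))).prod from
    H _ (List.pairwise_reverse.2 (List.pairwise_lt_finRange n)) (by simp)
  intro L hL hb
  induction L with
  | nil => simp at hb
  | cons j L ih =>
    rw [List.pairwise_cons] at hL
    simp only [List.map_cons, List.prod_cons]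
    rcases List.mem_cons.1 hb with rfl | hb
    · rw [← mul_assoc, h.mul_matCol_self r (hM.1 b)]
      congr 2
      refine List.map_congr_left fun k hk => ?_
      exact (h.matCol_of_eq_zero r (hM.2 _ _ (hL.1 k hk))).symm
    · rw [← mul_assoc, (h.semiconjBy_matCol hab (hL.1 b hb) r M).eq, mul_assoc, ih hL.2 hb]

theorem _root_.BorelPresentation.IsUnitriangular.transvection_mul {a b : Fin n} (hab : a < b)
    (r : R) {M : Matrix (Fin n) (Fin n) R} (hM : IsUnitriangular M) :
    IsUnitriangular (Matrix.transvection a b r * M) := by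
  refine ⟨fun i => ?_, fun i j hij => ?_⟩
  · by_cases hi : i = a
    · subst hi
      simp [Matrix.transvection_mul_apply_same, hM.1, hM.2 _ _ hab]
    · simp [hi, Matrix.transvection_mul_apply_of_ne, hM.1]
  · by_cases hi : i = a
    · subst hi
      simp [Matrix.transvection_mul_apply_same, hM.2 _ _ hij, hM.2 _ _ (hij.trans hab)]
    · simp [hi, Matrix.transvection_mul_apply_of_ne, hM.2 _ _ hij]

/-- Every element of `Q` has a normal form which can be read off from its image under a
representation by upper triangular matrices. -/
theorem exists_normalForm (h : IsBorelSystem x δ) (ρ : Q →* Matrix (Fin n) (Fin n) R)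
    (hρx : ∀ i j, i < j → ∀ r, ρ (x i j (.ofAdd r)) = Matrix.transvection i j r)
    (hρδ : ∀ t, ρ (δ t) = Matrix.diagonal fun i => (t.1 i : R)) (q : Q) :
    ∃ (M : Matrix (Fin n) (Fin n) R) (d : torus n R), IsUnitriangular M ∧
      q = h.unipotent M * δ d ∧ ρ q = M * Matrix.diagonal fun i => (d.1 i : R) := by
  have hx : ∀ i j, i < j → ∀ r q, (∃ (M : Matrix (Fin n) (Fin n) R) (d : torus n R),
      IsUnitriangular M ∧ q = h.unipotent M * δ d ∧
        ρ q = M * Matrix.diagonal fun i => (d.1 i : R)) →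
      ∃ (M : Matrix (Fin n) (Fin n) R) (d : torus n R), IsUnitriangular M ∧
        x i j (.ofAdd r) * q = h.unipotent M * δ d ∧
        ρ (x i j (.ofAdd r) * q) = M * Matrix.diagonal fun i => (d.1 i : R) := by
    rintro i j hij r q ⟨M, d, hM, hq, hρ⟩
    refine ⟨Matrix.transvection i j r * M, d, hM.transvection_mul hij r, ?_, ?_⟩
    · rw [hq, ← mul_assoc, h.mul_unipotent hij r hM]
    · rw [map_mul, hρ, hρx i j hij, mul_assoc]
  have hδ : ∀ t q, (∃ (M : Matrix (Fin n) (Fin n) R) (d : torus n R),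
      IsUnitriangular M ∧ q = h.unipotent M * δ d ∧
        ρ q = M * Matrix.diagonal fun i => (d.1 i : R)) →
      ∃ (M : Matrix (Fin n) (Fin n) R) (d : torus n R), IsUnitriangular M ∧
        δ t * q = h.unipotent M * δ d ∧
        ρ (δ t * q) = M * Matrix.diagonal fun i => (d.1 i : R) := by
    rintro t q ⟨M, d, hM, hq, hρ⟩
    refine ⟨.of fun i j => (rootChar i j t : R) * M i j, t * d, ⟨?_, ?_⟩, ?_, ?_⟩
    · simp [rootChar_apply, hM.1]
    · intro i j hij
      simp [hM.2 i j hij]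
    · rw [hq, ← mul_assoc, (h.semiconjBy_torus_unipotent t M).eq, mul_assoc, map_mul]
    · rw [map_mul, hρ, hρδ, ← mul_assoc]
      ext i j
      simp only [Matrix.mul_diagonal, Matrix.diagonal_mul, Matrix.of_apply, rootChar_apply,
        Subgroup.coe_mul, Pi.mul_apply, Units.val_mul, div_eq_mul_inv]
      linear_combination (-(t.1 i : R) * M i j * d.1 j) * (t.1 j).inv_mul
  have hq : q ∈ Subgroup.closure
      ({q | ∃ i j, i < j ∧ ∃ r : R, q = x i j (.ofAdd r)} ∪ Set.range δ) :=
    h.closure_eq_top ▸ Subgroup.mem_top q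
  induction hq using Subgroup.closure_induction_left with
  | one =>
    refine ⟨1, 1, ⟨by simp, fun i j hij => Matrix.one_apply_ne hij.ne'⟩, ?_, ?_⟩
    · simp [h.unipotent_one]
    · simp
  | mul_left y hy q _ ih =>
    rcases hy with ⟨i, j, hij, r, rfl⟩ | ⟨t, rfl⟩
    · exact hx i j hij r q ih
    · exact hδ t q ih
  | inv_mul_cancel y hy q _ ih =>
    rcases hy with ⟨i, j, hij, r, rfl⟩ | ⟨t, rfl⟩
    · rw [← map_inv, ← ofAdd_neg]
      exact hx i j hij (-r) q ih
    · rw [← map_inv]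
      exact hδ t⁻¹ q ih

theorem eq_one_of_map_eq_one (h : IsBorelSystem x δ) (ρ : Q →* Matrix (Fin n) (Fin n) R)
    (hρx : ∀ i j, i < j → ∀ r, ρ (x i j (.ofAdd r)) = Matrix.transvection i j r)
    (hρδ : ∀ t, ρ (δ t) = Matrix.diagonal fun i => (t.1 i : R)) (q : Q) (hq : ρ q = 1) :
    q = 1 := by
  obtain ⟨M, d, hM, rfl, hρ⟩ := h.exists_normalForm ρ hρx hρδ q
  rw [hq] at hρ
  have hd : d = 1 := by
    ext i
    have := congr_fun₂ hρ i i
    simpa [hM.1] using this.symm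
  subst hd
  have : M = 1 := by simpa using hρ.symm
  rw [this, h.unipotent_one, map_one, one_mul]

end IsBorelSystem

end BorelSystem

section Relations

variable {n : ℕ} {R Q : Type*} [CommRing R] [Group Q]

/-- A relation `⁅x r, y s⁆ = z (r * s)` with values commuting with `x` and `y` holds everywhere if
it holds on a set spanning `R` over `n`-th powers of units, provided that these powers can be
brought in separately on either side by conjugation. -/
theorem SpansOverPowers.bracket {M : Set R} (hM : SpansOverPowers n M)
    {x y z : Multiplicative R →* Q} (hxz : ∀ r s, Commute (x r) (z s))
    (hyz : ∀ r s, Commute (y r) (z s))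
    (hl : ∀ w : Rˣ, ∃ g : Q, (∀ r, SemiconjBy g (x (.ofAdd r)) (x (.ofAdd ((w : R) ^ n * r)))) ∧
      (∀ r, Commute g (y (.ofAdd r))) ∧
      ∀ r, SemiconjBy g (z (.ofAdd r)) (z (.ofAdd ((w : R) ^ n * r))))
    (hr : ∀ w : Rˣ, ∃ g : Q, (∀ r, Commute g (x (.ofAdd r))) ∧
      (∀ r, SemiconjBy g (y (.ofAdd r)) (y (.ofAdd ((w : R) ^ n * r)))) ∧
      ∀ r, SemiconjBy g (z (.ofAdd r)) (z (.ofAdd ((w : R) ^ n * r))))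
    (h : ∀ a ∈ M, ∀ b ∈ M,
      x (.ofAdd a) * y (.ofAdd b) = z (.ofAdd (a * b)) * y (.ofAdd b) * x (.ofAdd a))
    (r s : R) : x (.ofAdd r) * y (.ofAdd s) = z (.ofAdd (r * s)) * y (.ofAdd s) * x (.ofAdd r) := by
  have transport {g u u' v v' : Q} (hu : SemiconjBy g u u') (hv : SemiconjBy g v v')
      (huv : u = v) : u' = v' := by
    subst huv
    exact mul_right_cancel (hu.eq.symm.trans hv.eq)
  have left (s : R) (hs : ∀ a ∈ M,
      x (.ofAdd a) * y (.ofAdd s) = z (.ofAdd (a * s)) * y (.ofAdd s) * x (.ofAdd a)) (r : R) :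
      x (.ofAdd r) * y (.ofAdd s) = z (.ofAdd (r * s)) * y (.ofAdd s) * x (.ofAdd r) := by
    let A : AddSubgroup R :=
      { carrier := {r | x (.ofAdd r) * y (.ofAdd s) =
          z (.ofAdd (r * s)) * y (.ofAdd s) * x (.ofAdd r)}
        zero_mem' := by simp
        add_mem' := fun {a b} ha hb => by
          simp only [Set.mem_ofPred_eq] at *
          rw [add_mul, ofAdd_add, ofAdd_add, map_mul, map_mul, mul_assoc, hb, mul_assoc,
            ← mul_assoc, (hxz _ _).eq, mul_assoc, ← mul_assoc (x _), ha,
            ((Commute.all (Multiplicative.ofAdd (a * s)) (.ofAdd (b * s))).map z).eq]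
          simp only [mul_assoc]
        neg_mem' := fun {a} ha => by
          simp only [Set.mem_ofPred_eq] at *
          rw [neg_mul, ofAdd_neg, ofAdd_neg, map_inv, map_inv, inv_mul_eq_iff_eq_mul, ← mul_assoc,
            ← mul_assoc, eq_mul_inv_iff_mul_eq, (hxz _ _).inv_right.eq, mul_assoc,
            eq_inv_mul_iff_mul_eq, ← mul_assoc, ha] }
    have : A = ⊤ := hM A hs fun w r hw => by
      obtain ⟨g, hgx, hgy, hgz⟩ := hl w
      refine transport ((hgx r).mul_right (hgy s)) ?_ hw
      rw [mul_assoc (_ ^ n)]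
      exact ((hgz _).mul_right (hgy s)).mul_right (hgx r)
    exact (this ▸ AddSubgroup.mem_top r : r ∈ A)
  let A : AddSubgroup R :=
    { carrier := {s | x (.ofAdd r) * y (.ofAdd s) =
        z (.ofAdd (r * s)) * y (.ofAdd s) * x (.ofAdd r)}
      zero_mem' := by simp
      add_mem' := fun {a b} ha hb => by
        simp only [Set.mem_ofPred_eq] at *
        rw [mul_add, ofAdd_add, ofAdd_add, map_mul, map_mul, ← mul_assoc, ha, mul_assoc, hb,
          ← mul_assoc, ← mul_assoc, mul_assoc (z _) (y _) (z _), (hyz _ _).eq]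
        simp only [mul_assoc]
      neg_mem' := fun {a} ha => by
        simp only [Set.mem_ofPred_eq] at *
        rw [mul_neg, ofAdd_neg, ofAdd_neg, map_inv, map_inv, mul_inv_eq_iff_eq_mul, mul_assoc,
          mul_assoc, ha, mul_assoc (z _), ← mul_assoc, ← mul_assoc, mul_assoc (_)⁻¹ (_)⁻¹,
          ((hyz _ _).inv_left).eq]
        simp }
  have : A = ⊤ := hM A (fun b hb => left b (fun a ha => h a ha b hb) r) fun w s hw => by
    obtain ⟨g, hgx, hgy, hgz⟩ := hr w
    refine transport (SemiconjBy.mul_right (hgx r) (hgy s)) ?_ hw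
    rw [mul_left_comm]
    exact ((hgz _).mul_right (hgy s)).mul_right (hgx r)
  exact (this ▸ AddSubgroup.mem_top s : s ∈ A)

variable (n R) in
/-- The free product of the root groups of all positive roots. -/
abbrev RootProduct := CoprodI fun p : {p : Fin n × Fin n // p.1 < p.2} => RootGroup R p.1.1 p.1.2

/-- The image of a root subgroup element in the free product. -/
def RootProduct.root {i j : Fin n} (hij : i < j) : Multiplicative R →* RootProduct n R :=
  (CoprodI.of (M := fun p : {p : Fin n × Fin n // p.1 < p.2} => RootGroup R p.1.1 p.1.2)
    (i := ⟨(i, j), hij⟩)).comp SemidirectProduct.inl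

/-- The image of a torus element in the free product. -/
def RootProduct.tor {i j : Fin n} (hij : i < j) : torus n R →* RootProduct n R :=
  (CoprodI.of (M := fun p : {p : Fin n × Fin n // p.1 < p.2} => RootGroup R p.1.1 p.1.2)
    (i := ⟨(i, j), hij⟩)).comp SemidirectProduct.inr

open RootProduct

/-- Relators for the Borel subgroup over the free product of the root groups: identification of
the tori, and the commutator relations between the elements of `M` in distinct roots. -/
def relators (S : Set (torus n R)) (M : Set R) : Set (RootProduct n R) :=
  (⋃ (i) (j) (k) (l) (hij : i < j) (hkl : k < l),
    (fun t => tor hij t * (tor hkl t)⁻¹) '' S) ∪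
  (⋃ (i) (j) (k) (l) (hij : i < j) (hkl : k < l) (_ : j ≠ k) (_ : l ≠ i),
    Set.image2 (fun a b => root hij (.ofAdd a) * root hkl (.ofAdd b) *
      (root hkl (.ofAdd b) * root hij (.ofAdd a))⁻¹) M M) ∪
  ⋃ (i) (j) (l) (hij : i < j) (hjl : j < l),
    Set.image2 (fun a b => root hij (.ofAdd a) * root hjl (.ofAdd b) *
      (root (hij.trans hjl) (.ofAdd (a * b)) * root hjl (.ofAdd b) * root hij (.ofAdd a))⁻¹) M M

theorem relators_finite {S : Set (torus n R)} {M : Set R} (hS : S.Finite) (hM : M.Finite) :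
    (relators S M).Finite := by
  refine .union (.union ?_ ?_) ?_ <;> repeat' refine Set.finite_iUnion fun _ => ?_
  · exact hS.image _
  · exact hM.image2 _ hM
  · exact hM.image2 _ hM

theorem RootProduct.semiconjBy_tor_root {i j : Fin n} (hij : i < j) (t : torus n R) (r : R) :
    SemiconjBy (tor hij t) (root hij (.ofAdd r))
      (root hij (.ofAdd ((rootChar i j t : R) * r))) := by
  simp only [SemiconjBy, tor, root, MonoidHom.comp_apply, ← map_mul, RootGroup.inr_mul_inl]

theorem RootProduct.closure_eq_top : Subgroup.closure
    ({e | ∃ (i j : Fin n) (hij : i < j) (r : R), e = root hij (.ofAdd r)} ∪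
      {e | ∃ (i j : Fin n) (hij : i < j) (t : torus n R), e = tor hij t}) = ⊤ := by
  rw [eq_top_iff]
  intro e _
  induction e using CoprodI.induction_on with
  | one => exact one_mem _
  | mul a b ha hb => exact mul_mem (ha trivial) (hb trivial)
  | of p g =>
    rw [← SemidirectProduct.inl_left_mul_inr_right g, map_mul]
    refine mul_mem (Subgroup.subset_closure (.inl ?_)) (Subgroup.subset_closure (.inr ?_))
    · exact ⟨_, _, p.2, g.left.toAdd, rfl⟩
    · exact ⟨_, _, p.2, g.right, rfl⟩

/-- In a quotient of the free product of the root groups satisfying the relators, all the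
defining relations of the Borel subgroup hold. -/
theorem isBorelSystem_of_relators {S : Set (torus n R)} {M : Set R}
    (hS : Subgroup.closure S = ⊤) (hM : SpansOverPowers n M) (f : RootProduct n R →* Q)
    (hf : Function.Surjective f) (hrel : ∀ e ∈ relators S M, f e = 1) {a b : Fin n} (hab : a < b) :
    IsBorelSystem (fun i j => if h : i < j then f.comp (root h) else 1) (f.comp (tor hab)) := by
  have htor {i j : Fin n} (hij : i < j) (t : torus n R) : f (tor hij t) = f (tor hab t) := by
    have : f.comp (tor hij) = f.comp (tor hab) := MonoidHom.eq_of_eqOn_dense hS fun t ht => by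
      rw [MonoidHom.comp_apply, MonoidHom.comp_apply, ← mul_inv_eq_one, ← map_inv, ← map_mul]
      refine hrel _ (Or.inl (Or.inl ?_))
      simp only [Set.mem_iUnion]
      exact ⟨_, _, _, _, hij, hab, t, ht, rfl⟩
    exact DFunLike.congr_fun this t
  have hconj {i j : Fin n} (hij : i < j) (t : torus n R) (r : R) {u : R}
      (hu : (rootChar i j t : R) = u) : SemiconjBy (f (tor hab t)) (f (root hij (.ofAdd r)))
      (f (root hij (.ofAdd (u * r)))) := by
    rw [← htor hij, ← hu]
    exact (semiconjBy_tor_root hij t r).map f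
  have hcent {i j : Fin n} (hij : i < j) (t : torus n R) (r : R)
      (hu : rootChar i j t = 1) : Commute (f (tor hab t)) (f (root hij (.ofAdd r))) := by
    have := hconj hij t r (u := 1) (by simp [hu])
    rw [one_mul] at this
    exact this
  have hcomm {i j k l : Fin n} (hij : i < j) (hkl : k < l) (hjk : j ≠ k) (hli : l ≠ i)
      (r s : Multiplicative R) : Commute (f (root hij r)) (f (root hkl s)) := by
    by_cases heq : i = k ∧ j = l
    · obtain ⟨rfl, rfl⟩ := heq
      exact ((Commute.all r s).map (root hij)).map f
    have := hM.bracket (x := f.comp (root hij)) (y := f.comp (root hkl)) (z := 1) (by simp)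
      (by simp) (fun w => ?_) (fun w => ?_) (fun a ha b hb => ?_) r.toAdd s.toAdd
    · simpa [commute_iff_eq] using this
    · obtain ⟨t, ht, ht'⟩ := exists_torus_rootChar (k := k) (l := l) hij.ne (by grind) w
      exact ⟨f (tor hab t), fun r => hconj hij t r (by simp [ht]), fun r => hcent hkl t r ht',
        by simp⟩
    · obtain ⟨t, ht, ht'⟩ := exists_torus_rootChar (k := i) (l := j) hkl.ne (by grind) w
      exact ⟨f (tor hab t), fun r => hcent hij t r ht', fun r => hconj hkl t r (by simp [ht]),
        by simp⟩
    · simp only [MonoidHom.comp_apply, MonoidHom.one_apply, one_mul, ← map_mul]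
      rw [← mul_inv_eq_one, ← map_inv, ← map_mul]
      refine hrel _ (Or.inl (Or.inr ?_))
      simp only [Set.mem_iUnion]
      exact ⟨_, _, _, _, hij, hkl, hjk, hli, a, ha, b, hb, rfl⟩
  refine ⟨?_, ?_, ?_, ?_, ?_⟩
  · intro i j hij
    simp [hij]
  · intro i j hij t r
    simpa [hij] using hconj hij t r rfl
  · intro i j k l hij hkl hjk hli r s
    simpa [hij, hkl] using hcomm hij hkl hjk hli r s
  · intro i j l hij hjl r s
    have hil := hij.trans hjl
    simp only [hij, hjl, hil, dif_pos]
    refine hM.bracket (x := f.comp (root hij)) (y := f.comp (root hjl)) (z := f.comp (root hil))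
      (fun r s => hcomm hij hil hij.ne' hil.ne' r s) (fun r s => hcomm hjl hil hil.ne' hjl.ne' r s)
      (fun w => ?_) (fun w => ?_) (fun a ha b hb => ?_) r s
    · obtain ⟨t, ht, ht'⟩ := exists_torus_rootChar (k := j) (l := l) hij.ne (by grind) w
      exact ⟨f (tor hab t), fun r => hconj hij t r (by simp [ht]), fun r => hcent hjl t r ht',
        fun r => hconj hil t r (by simp [← rootChar_mul_rootChar i j l, ht, ht'])⟩
    · obtain ⟨t, ht, ht'⟩ := exists_torus_rootChar (k := i) (l := j) hjl.ne (by grind) w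
      exact ⟨f (tor hab t), fun r => hcent hij t r ht', fun r => hconj hjl t r (by simp [ht]),
        fun r => hconj hil t r (by simp [← rootChar_mul_rootChar i j l, ht, ht'])⟩
    · simp only [MonoidHom.comp_apply, ← map_mul]
      rw [← mul_inv_eq_one, ← map_inv, ← map_mul]
      refine hrel _ (Or.inr ?_)
      simp only [Set.mem_iUnion]
      exact ⟨_, _, _, hij, hjl, a, ha, b, hb, rfl⟩
  · rw [← (MonoidHom.range_eq_top.2 hf), MonoidHom.range_eq_map, ← RootProduct.closure_eq_top,
      MonoidHom.map_closure]
    congr 1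
    ext q
    constructor
    · rintro (⟨i, j, hij, r, rfl⟩ | ⟨t, rfl⟩)
      · exact ⟨_, .inl ⟨i, j, hij, r, rfl⟩, by simp [hij]⟩
      · exact ⟨_, .inr ⟨a, b, hab, t, rfl⟩, rfl⟩
    · rintro ⟨_, ⟨i, j, hij, r, rfl⟩ | ⟨i, j, hij, t, rfl⟩, rfl⟩
      · exact .inl ⟨i, j, hij, r, by simp [hij]⟩
      · exact .inr ⟨t, (htor hij t).symm⟩

end Relations

section SpecialLinear

variable {n : ℕ} {R : Type*} [CommRing R]

/-- The root subgroup of `SL_n(R)` as a homomorphism. -/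
def elemHom {i j : Fin n} (hij : i ≠ j) :
    Multiplicative R →* Matrix.SpecialLinearGroup (Fin n) R where
  toFun r := elemMat i j hij r.toAdd
  map_one' := Subtype.ext (by simp [elemMat])
  map_mul' r s := Subtype.ext <| by
    rw [Matrix.SpecialLinearGroup.coe_mul]
    exact (Matrix.transvection_mul_transvection_same i j hij _ _).symm

theorem coe_elemHom {i j : Fin n} (hij : i ≠ j) (r : Multiplicative R) :
    (elemHom hij r : Matrix (Fin n) (Fin n) R) = Matrix.transvection i j r.toAdd := rfl

/-- The torus as the group of diagonal matrices in `SL_n(R)`. -/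
def diagHom : torus n R →* Matrix.SpecialLinearGroup (Fin n) R where
  toFun t := ⟨Matrix.diagonal fun i => (t.1 i : R), by
    have : ∏ i, t.1 i = 1 := t.2
    rw [Matrix.det_diagonal, ← Units.coe_prod, this, Units.val_one]⟩
  map_one' := Subtype.ext (by simp)
  map_mul' s t := Subtype.ext (Matrix.diagonal_mul_diagonal _ _).symm

theorem coe_diagHom (t : torus n R) :
    (diagHom t : Matrix (Fin n) (Fin n) R) = Matrix.diagonal fun i => (t.1 i : R) := rfl

theorem range_diagHom : Set.range (diagHom (n := n) (R := R)) = diagMats n R := by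
  ext g
  constructor
  · rintro ⟨t, rfl⟩
    exact Matrix.isDiag_diagonal _
  · intro hg
    obtain ⟨d, hd⟩ : ∃ d, (g : Matrix (Fin n) (Fin n) R) = Matrix.diagonal d :=
      ⟨_, (Matrix.IsDiag.diagonal_diag hg).symm⟩
    have hdet : ∏ i, d i = 1 := by
      rw [← Matrix.det_diagonal, ← hd, g.2]
    have hu (i : Fin n) : IsUnit (d i) :=
      isUnit_of_dvd_one (hdet ▸ Finset.dvd_prod_of_mem d (Finset.mem_univ i))
    choose u hu using hu
    refine ⟨⟨u, ?_⟩, Subtype.ext ?_⟩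
    · change ∏ i, u i = 1
      ext
      simp [hu, hdet]
    · simp [coe_diagHom, hu, hd]

/-- The root group inside `SL_n(R)`. -/
def rootHom {i j : Fin n} (hij : i ≠ j) :
    RootGroup R i j →* Matrix.SpecialLinearGroup (Fin n) R :=
  SemidirectProduct.lift (elemHom hij) diagHom fun t => by
    refine MonoidHom.ext fun r => ?_
    have : elemHom hij (unitsMulAut R (rootChar i j t) r) * diagHom t =
        diagHom t * elemHom hij r := by
      refine Subtype.ext ?_
      have key : ((rootChar i j t : R) * r.toAdd) * t.1 j = t.1 i * r.toAdd := by
        simp only [rootChar_apply, div_eq_mul_inv, Units.val_mul]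
        linear_combination (t.1 i * r.toAdd : R) * (t.1 j).inv_mul
      ext a b
      simp only [Matrix.SpecialLinearGroup.coe_mul, coe_elemHom, coe_diagHom, Matrix.transvection,
        add_mul, mul_add, Matrix.add_apply, Matrix.mul_diagonal,
        Matrix.diagonal_mul, Matrix.single_apply]
      congr 1
      · rcases eq_or_ne a b with rfl | h
        · simp
        · simp [h]
      · split_ifs with h
        · obtain ⟨rfl, rfl⟩ := h
          exact key
        · simp
    simpa [eq_mul_inv_iff_mul_eq] using this

@[simp]
theorem rootHom_inl {i j : Fin n} (hij : i ≠ j) (r : Multiplicative R) :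
    rootHom hij (SemidirectProduct.inl r) = elemHom hij r :=
  SemidirectProduct.lift_inl _ _ _ _

@[simp]
theorem rootHom_inr {i j : Fin n} (hij : i ≠ j) (t : torus n R) :
    rootHom hij (SemidirectProduct.inr t) = diagHom t :=
  SemidirectProduct.lift_inr _ _ _ _

theorem rootHom_injective {i j : Fin n} (hij : i ≠ j) :
    Function.Injective (rootHom (R := R) hij) := by
  rw [injective_iff_map_eq_one]
  intro g hg
  rw [← SemidirectProduct.inl_left_mul_inr_right g, map_mul, rootHom_inl, rootHom_inr] at hg
  have h (a b : Fin n) := congr_fun₂ (congr_arg Subtype.val hg) a b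
  simp only [Matrix.SpecialLinearGroup.coe_mul, coe_elemHom, coe_diagHom, Matrix.mul_diagonal,
    Matrix.SpecialLinearGroup.coe_one] at h
  have hright : g.right = 1 := by
    ext a
    have := h a a
    have ha : ¬ (i = a ∧ j = a) := fun h => hij (h.1.trans h.2.symm)
    simpa [Matrix.transvection, Matrix.single_apply, ha] using this
  have hleft : g.left = 1 := by
    have := h i j
    simpa [Matrix.transvection, hright, hij] using this
  exact SemidirectProduct.ext hleft hright

theorem range_rootHom {i j : Fin n} (hij : i ≠ j) :
    (rootHom (R := R) hij).range =
      Subgroup.closure (diagMats n R ∪ {g | ∃ r : R, g = elemMat i j hij r}) := by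
  refine le_antisymm ?_ ((Subgroup.closure_le _).2 ?_)
  · rintro _ ⟨g, rfl⟩
    rw [← SemidirectProduct.inl_left_mul_inr_right g, map_mul, rootHom_inl, rootHom_inr]
    refine mul_mem (Subgroup.subset_closure (Or.inr ⟨g.left.toAdd, rfl⟩))
      (Subgroup.subset_closure (Or.inl ?_))
    exact range_diagHom (n := n) (R := R) ▸ ⟨_, rfl⟩
  · rintro _ (hg | ⟨r, rfl⟩)
    · rw [← range_diagHom] at hg
      obtain ⟨t, rfl⟩ := hg
      exact ⟨SemidirectProduct.inr t, rootHom_inr _ _⟩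
    · exact ⟨SemidirectProduct.inl (.ofAdd r), rootHom_inl _ _⟩

theorem borelExtLevi_eq_range {i j : Fin n} (hij : i ≠ j) (h : j.val = i.val + 1) :
    borelExtLevi n R j.val = (rootHom (R := R) hij).range := by
  rw [range_rootHom, borelExtLevi]
  congr 2
  ext g
  constructor
  · rintro ⟨a, b, hab, r, hc, rfl⟩
    have h1 : a.val + 1 = j.val := hc _ le_rfl hab
    have h2 : b.val = j.val := hc _ hab le_rfl
    obtain rfl : a = i := Fin.ext (by lia)
    obtain rfl : b = j := Fin.ext h2
    exact ⟨r, rfl⟩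
  · rintro ⟨r, rfl⟩
    exact ⟨i, j, Fin.lt_def.2 (by lia), r, fun k hk hk' => le_antisymm hk' (by lia), rfl⟩

/-- The homomorphism from the free product of the root groups onto the Borel subgroup. -/
def borelHom (n : ℕ) (R : Type*) [CommRing R] :
    RootProduct n R →* Matrix.SpecialLinearGroup (Fin n) R :=
  CoprodI.lift fun p => rootHom p.2.ne

theorem borelHom_root {i j : Fin n} (hij : i < j) (r : Multiplicative R) :
    borelHom n R (RootProduct.root hij r) = elemHom hij.ne r := by
  simp [borelHom, RootProduct.root]

theorem borelHom_tor {i j : Fin n} (hij : i < j) (t : torus n R) :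
    borelHom n R (RootProduct.tor hij t) = diagHom t := by
  simp [borelHom, RootProduct.tor]

theorem lowerElems_empty : lowerElems n R ∅ = ∅ := by
  refine Set.eq_empty_of_forall_notMem ?_
  rintro _ ⟨i, j, hij, r, hc, -⟩
  exact hc _ le_rfl hij

theorem range_borelHom {i j : Fin n} (hij : i < j) : (borelHom n R).range = parabolic n R ∅ := by
  rw [parabolic, lowerElems_empty, Set.union_empty, MonoidHom.range_eq_map,
    ← RootProduct.closure_eq_top, MonoidHom.map_closure, ← range_diagHom]
  congr 1
  ext g
  constructor
  · rintro ⟨_, ⟨a, b, hab, r, rfl⟩ | ⟨a, b, hab, t, rfl⟩, rfl⟩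
    · exact Or.inr ⟨a, b, hab, r, borelHom_root hab _⟩
    · exact Or.inl ⟨t, (borelHom_tor hab t).symm⟩
  · rintro (⟨t, rfl⟩ | ⟨a, b, hab, r, rfl⟩)
    · exact ⟨_, Or.inr ⟨i, j, hij, t, rfl⟩, borelHom_tor hij t⟩
    · exact ⟨_, Or.inl ⟨a, b, hab, r, rfl⟩, borelHom_root hab _⟩

theorem transvection_mul_transvection_of_ne {i j k l : Fin n} (hjk : j ≠ k) (r s : R) :
    Matrix.transvection i j r * Matrix.transvection k l s =
      1 + Matrix.single i j r + Matrix.single k l s := by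
  simp [Matrix.transvection, add_mul, mul_add, hjk, add_assoc, add_comm (Matrix.single k l s)]

theorem elemHom_commute {i j k l : Fin n} (hij : i < j) (hkl : k < l) (hjk : j ≠ k) (hli : l ≠ i)
    (r s : Multiplicative R) : Commute (elemHom hij.ne r) (elemHom hkl.ne s) :=
  Subtype.ext <| by
    simp only [Matrix.SpecialLinearGroup.coe_mul, coe_elemHom,
      transvection_mul_transvection_of_ne hjk, transvection_mul_transvection_of_ne hli]
    abel

theorem elemHom_bracket {i j l : Fin n} (hij : i < j) (hjl : j < l) (r s : R) :
    elemHom hij.ne (.ofAdd r) * elemHom hjl.ne (.ofAdd s) =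
      elemHom (hij.trans hjl).ne (.ofAdd (r * s)) * elemHom hjl.ne (.ofAdd s) *
        elemHom hij.ne (.ofAdd r) :=
  Subtype.ext <| by
    simp only [Matrix.SpecialLinearGroup.coe_mul, coe_elemHom, mul_assoc,
      transvection_mul_transvection_of_ne (hij.trans hjl).ne']
    simp [Matrix.transvection, add_mul, mul_add, (hij.trans hjl).ne']
    simp [hjl.ne']
    abel

theorem borelHom_eq_one_of_mem_relators {S : Set (torus n R)} {M : Set R} {e : RootProduct n R}
    (he : e ∈ relators S M) : borelHom n R e = 1 := by
  rcases he with (he | he) | he <;> simp only [Set.mem_iUnion] at he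
  · obtain ⟨i, j, k, l, hij, hkl, t, -, rfl⟩ := he
    simp [borelHom_tor]
  · obtain ⟨i, j, k, l, hij, hkl, hjk, hli, a, -, b, -, rfl⟩ := he
    simp only [map_mul, map_inv, borelHom_root, mul_inv_eq_one]
    exact elemHom_commute hij hkl hjk hli _ _
  · obtain ⟨i, j, l, hij, hjl, a, -, b, -, rfl⟩ := he
    simp only [map_mul, map_inv, borelHom_root, mul_inv_eq_one]
    exact elemHom_bracket hij hjl a b

/-- If one root group is finitely presented, then so is the Borel subgroup. -/
theorem finitelyPresented_borel {i j : Fin n} (hij : i < j)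
    [h : Group.IsFinitelyPresented (RootGroup R i j)] :
    Group.IsFinitelyPresented (parabolic n R ∅) := by
  have hroot (p : {p : Fin n × Fin n // p.1 < p.2}) :
      Group.IsFinitelyPresented (RootGroup R p.1.1 p.1.2) :=
    have ⟨e⟩ := RootGroup.nonempty_mulEquiv (R := R) hij.ne p.2.ne
    .equiv e
  have := finitelyPresented_coprodI _ hroot
  have : Group.FG (RootGroup R i j) := by
    obtain ⟨m, φ, hφ, -⟩ := h.out
    exact Group.fg_of_surjective hφ
  obtain ⟨M, hMfin, hM⟩ := exists_finite_spansOverPowers (R := R) i.pos i j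
  obtain ⟨S, hS⟩ := (torus_fg_of_rootGroup_fg (R := R) i j).out
  let N := Subgroup.normalClosure (relators (S : Set (torus n R)) M)
  have hN : N ≤ (borelHom n R).ker := Subgroup.normalClosure_le_normal fun e he =>
    borelHom_eq_one_of_mem_relators he
  have sys := isBorelSystem_of_relators hS hM (QuotientGroup.mk' N) (QuotientGroup.mk'_surjective N)
    (fun e he => (QuotientGroup.eq_one_iff e).2 (Subgroup.subset_normalClosure he)) hij
  let ρ : RootProduct n R ⧸ N →* Matrix (Fin n) (Fin n) R :=
    ((Units.coeHom _).comp Matrix.SpecialLinearGroup.toGL).comp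
      (QuotientGroup.lift N (borelHom n R) hN)
  rw [← range_borelHom hij]
  refine .of_surjective (borelHom n R).rangeRestrict (MonoidHom.rangeRestrict_surjective _)
    ⟨_, relators_finite S.finite_toSet hMfin, ?_⟩
  rw [MonoidHom.ker_rangeRestrict]
  refine le_antisymm hN fun e he => (QuotientGroup.eq_one_iff e).1 ?_
  refine sys.eq_one_of_map_eq_one ρ (fun a b hab r => ?_) (fun t => ?_) _ ?_
  · simp [ρ, hab, borelHom_root, coe_elemHom]
  · simp [ρ, borelHom_tor, coe_diagHom]
  · have : borelHom n R e = 1 := he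
    simp [ρ, this]

end SpecialLinear

section Retraction

variable {n : ℕ} {R : Type*} [CommRing R]

/-- The subgroup of all upper triangular matrices in `SL_n(R)`. -/
def upperSubgroup (n : ℕ) (R : Type*) [CommRing R] :
    Subgroup (Matrix.SpecialLinearGroup (Fin n) R) where
  carrier := {g | (g : Matrix (Fin n) (Fin n) R).BlockTriangular id ∧
    ((g⁻¹ : Matrix.SpecialLinearGroup (Fin n) R) : Matrix (Fin n) (Fin n) R).BlockTriangular id}
  one_mem' := by simp [Matrix.blockTriangular_one]
  mul_mem' {g h} hg hh := by
    refine ⟨?_, ?_⟩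
    · rw [Matrix.SpecialLinearGroup.coe_mul]
      exact hg.1.mul hh.1
    · rw [mul_inv_rev, Matrix.SpecialLinearGroup.coe_mul]
      exact hh.2.mul hg.2
  inv_mem' {g} hg := ⟨hg.2, by rw [inv_inv]; exact hg.1⟩

theorem elemHom_mem_upperSubgroup {i j : Fin n} (hij : i < j) (r : Multiplicative R) :
    elemHom hij.ne r ∈ upperSubgroup n R := by
  have (r : Multiplicative R) :
      (elemHom hij.ne r : Matrix (Fin n) (Fin n) R).BlockTriangular id :=
    Matrix.blockTriangular_transvection hij.le _
  exact ⟨this r, by rw [← map_inv]; exact this r⁻¹⟩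

theorem diagHom_mem_upperSubgroup (t : torus n R) : diagHom t ∈ upperSubgroup n R := by
  have (t : torus n R) : (diagHom t : Matrix (Fin n) (Fin n) R).BlockTriangular id :=
    Matrix.blockTriangular_diagonal _
  exact ⟨this t, by rw [← map_inv]; exact this t⁻¹⟩

theorem parabolic_empty_le_upperSubgroup : parabolic n R ∅ ≤ upperSubgroup n R := by
  rw [parabolic, lowerElems_empty, Set.union_empty, Subgroup.closure_le, ← range_diagHom]
  rintro _ (⟨t, rfl⟩ | ⟨i, j, hij, r, rfl⟩)
  · exact diagHom_mem_upperSubgroup t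
  · exact elemHom_mem_upperSubgroup hij (.ofAdd r)

theorem mul_apply_diag {g h : Matrix (Fin n) (Fin n) R} (hg : g.BlockTriangular id)
    (hh : h.BlockTriangular id) (i : Fin n) : (g * h) i i = g i i * h i i := by
  rw [Matrix.mul_apply]
  refine Finset.sum_eq_single i (fun k _ hk => ?_) (by simp)
  rcases lt_or_gt_of_ne hk with hk | hk
  · rw [hg hk, zero_mul]
  · rw [hh hk, mul_zero]

theorem mul_apply_succ {g h : Matrix (Fin n) (Fin n) R} (hg : g.BlockTriangular id)
    (hh : h.BlockTriangular id) {i j : Fin n} (hij : j.val = i.val + 1) :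
    (g * h) i j = g i i * h i j + g i j * h j j := by
  rw [Matrix.mul_apply]
  refine Finset.sum_eq_add i j (by rintro rfl; lia) (fun k _ hk => ?_) (by simp) (by simp)
  rcases lt_or_gt_of_ne hk.1 with hki | hki
  · rw [hg hki, zero_mul]
  · have : j < k := lt_of_le_of_ne (Fin.le_def.2 (by have := Fin.lt_def.1 hki; lia)) hk.2.symm
    rw [hh this, mul_zero]

theorem apply_mul_inv_apply {g : Matrix.SpecialLinearGroup (Fin n) R}
    (hg : g ∈ upperSubgroup n R) (i : Fin n) : g i i * g⁻¹ i i = 1 := by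
  rw [← mul_apply_diag hg.1 hg.2, ← Matrix.SpecialLinearGroup.coe_mul, mul_inv_cancel]
  simp

/-- The diagonal part of an upper triangular matrix. -/
def upperDiag : upperSubgroup n R →* torus n R where
  toFun g := ⟨fun i => ⟨g.1 i i, g.1⁻¹ i i, apply_mul_inv_apply g.2 i,
    (mul_comm _ _).trans (apply_mul_inv_apply g.2 i)⟩, by
      change ∏ i, _ = 1
      ext
      rw [Units.coe_prod, Units.val_one]
      exact (Matrix.det_of_isUpperTriangular g.2.1).symm.trans g.1.2⟩
  map_one' := by ext; simp
  map_mul' g h := by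
    ext i
    exact mul_apply_diag g.2.1 h.2.1 i

/-- The projection of the upper triangular matrices onto the root group of a simple root. -/
def upperProj {i j : Fin n} (hij : j.val = i.val + 1) : upperSubgroup n R →* RootGroup R i j where
  toFun g := ⟨.ofAdd (g.1 i j * g.1⁻¹ j j), upperDiag g⟩
  map_one' := by
    have : i ≠ j := by rintro rfl; lia
    ext <;> simp [this]
  map_mul' g h := by
    refine SemidirectProduct.ext ?_ (map_mul _ _ _)
    change (g.1 * h.1).1 i j * (g.1 * h.1)⁻¹.1 j j =
      g.1 i j * g.1⁻¹ j j + (g.1 i i * g.1⁻¹ j j) * (h.1 i j * h.1⁻¹ j j)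
    rw [mul_inv_rev, Matrix.SpecialLinearGroup.coe_mul, Matrix.SpecialLinearGroup.coe_mul,
      mul_apply_succ g.2.1 h.2.1 hij, mul_apply_diag h.2.2 g.2.2]
    linear_combination (g.1 i j * g.1⁻¹ j j) * apply_mul_inv_apply h.2 j

/-- The root group of a simple root is a retract of the Borel subgroup. -/
theorem finitelyPresented_rootGroup {i j : Fin n} (hij : j.val = i.val + 1)
    [Group.IsFinitelyPresented (parabolic n R ∅)] :
    Group.IsFinitelyPresented (RootGroup R i j) := by
  have hlt : i < j := Fin.lt_def.2 (by lia)
  have hmem (g : RootGroup R i j) : rootHom hlt.ne g ∈ parabolic n R ∅ := by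
    rw [← range_borelHom hlt]
    exact ⟨CoprodI.of (M := fun p : {p : Fin n × Fin n // p.1 < p.2} => RootGroup R p.1.1 p.1.2)
      (i := ⟨(i, j), hlt⟩) g, CoprodI.lift_of _ _⟩
  refine finitelyPresented_of_retract
    ((upperProj hij).comp (Subgroup.inclusion parabolic_empty_le_upperSubgroup))
    ((rootHom hlt.ne).codRestrict _ hmem) (SemidirectProduct.hom_ext ?_ ?_)
  · refine MonoidHom.ext fun r => ?_
    have hinv : (elemHom hlt.ne r)⁻¹ = elemHom hlt.ne r⁻¹ := (map_inv _ _).symm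
    refine SemidirectProduct.ext ?_ ?_
    · change (rootHom hlt.ne (.inl r)).1 i j * (rootHom hlt.ne (.inl r))⁻¹.1 j j = r.toAdd
      rw [rootHom_inl, hinv, coe_elemHom, coe_elemHom]
      simp [Matrix.transvection, hlt.ne]
    · ext a
      change (rootHom hlt.ne (.inl r)).1 a a = 1
      have ha : ¬ (i = a ∧ j = a) := fun h => hlt.ne (h.1.trans h.2.symm)
      rw [rootHom_inl, coe_elemHom]
      simp [Matrix.transvection, ha]
  · refine MonoidHom.ext fun t => ?_
    refine SemidirectProduct.ext ?_ ?_
    · change (rootHom hlt.ne (.inr t)).1 i j * (rootHom hlt.ne (.inr t))⁻¹.1 j j = 0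
      rw [rootHom_inr, coe_diagHom]
      simp [hlt.ne]
    · ext a
      change (rootHom hlt.ne (.inr t)).1 a a = t.1 a
      rw [rootHom_inr, coe_diagHom]
      simp

end Retraction

end BorelPresentation

/-- If all standard parabolic subgroups of SL_n(R) are finitely generated, then the
standard Borel subgroup P_∅(R) is finitely presented iff every extended Levi factor
LE_k(R), k ∈ {1,…,n−1}, is finitely presented. -/
theorem borel_finitelyPresented_iff_extLevis
    {R : Type*} [CommRing R] {n : ℕ} (hn : 2 ≤ n)
    (hfg : ∀ J : Set ℕ, J ⊆ Set.Icc 1 (n - 1) → Group.FG ↥(parabolic n R J)) :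
    IsFinitelyPresented ↥(parabolic n R (∅ : Set ℕ)) ↔
      ∀ k ∈ Set.Icc 1 (n - 1), IsFinitelyPresented ↥(borelExtLevi n R k) := by
  simp only [BorelPresentation.isFinitelyPresented_iff]
  constructor
  · intro h k hk
    obtain ⟨hk1, hk2⟩ := Set.mem_Icc.1 hk
    let i : Fin n := ⟨k - 1, by lia⟩
    let j : Fin n := ⟨k, by lia⟩
    have hij : j.val = i.val + 1 := by simp only [i, j]; lia
    have hne : i ≠ j := fun h => by rw [h] at hij; lia
    have := BorelPresentation.finitelyPresented_rootGroup (R := R) hij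
    change Group.IsFinitelyPresented (borelExtLevi n R j.val)
    rw [BorelPresentation.borelExtLevi_eq_range hne hij]
    exact .equiv (MonoidHom.ofInjective (BorelPresentation.rootHom_injective hne))
  · intro h
    let i : Fin n := ⟨0, by lia⟩
    let j : Fin n := ⟨1, by lia⟩
    have hij : i < j := Fin.lt_def.2 one_pos
    have h1 := h j.val (Set.mem_Icc.2 ⟨le_rfl, by simp only [j]; lia⟩)
    rw [BorelPresentation.borelExtLevi_eq_range hij.ne rfl] at h1
    have : Group.IsFinitelyPresented (BorelPresentation.RootGroup R i j) :=
      .equiv (MonoidHom.ofInjective (BorelPresentation.rootHom_injective hij.ne)).symm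
    exact BorelPresentation.finitelyPresented_borel hij
end
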